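/- Fix real numbers α, β ≥ 1 with αβ > 1. For N ≥ 1 let 𝒮_B(α,β;N) be the set of matrices (p′, −p; q′, −q) ∈ SL(2,ℤ) with integer entries satisfying p ≥ αq, p′ ≥ βp, p′ > q′ > q ≥ 0, and p′ − q ≤ N. Then for every ε > 0 there is a constant C = C(α,β,ε) > 0 such that for all N ≥ 1, | |𝒮_B(α,β;N)| − (N²/(2ζ(2)))·log(αβ/(αβ−1)) | ≤ C·N^{3/2+ε}, where ζ(2) = π²/6. -/

import Mathlib

noncomputable section

open Polynomial


/-- independence lemma -/
theorem stp_indep {F : Type*} [Field F] {r M : ℕ} (D : F[X]) (hr : 0 < r)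
    (hDr : D ^ r = expand F r D) (hodd : Odd r) (e : ℕ) (hdeg : D.natDegree ≤ 2 * e)
    (hsq : ∀ a b : F[X], a ^ 2 = C (D.eval 0) * D * b ^ 2 → a = 0 ∧ b = 0)
    (a b : ℕ → F[X]) (ha : ∀ k, 2 * (a k).natDegree < r) (hb : ∀ k, 2 * (b k).natDegree + 2 * e < r)
    (h0 : ∑ k ∈ Finset.range M, (a k + b k * D ^ ((r + 1) / 2)) * X ^ (r * k) = 0) :
    ∀ k < M, a k = 0 ∧ b k = 0 := by
  intro k
  induction k using Nat.strong_induction_on with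
  | _ k ih =>
  intro hk
  have hdvd : X ^ r ∣ a k + b k * D ^ ((r + 1) / 2) := by
    have h1 : X ^ (r * (k + 1)) ∣ (a k + b k * D ^ ((r + 1) / 2)) * X ^ (r * k) := by
      have h2 : (a k + b k * D ^ ((r + 1) / 2)) * X ^ (r * k) =
          - ∑ j ∈ (Finset.range M).erase k, (a j + b j * D ^ ((r + 1) / 2)) * X ^ (r * j) := by
        rw [← Finset.add_sum_erase _ _ (Finset.mem_range.2 hk)] at h0
        exact eq_neg_of_add_eq_zero_left h0
      rw [h2, dvd_neg]
      apply Finset.dvd_sum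
      intro j hj
      rw [Finset.mem_erase, Finset.mem_range] at hj
      rcases lt_or_gt_of_ne hj.1 with h | h
      · obtain ⟨e1, e2⟩ := ih j h hj.2
        simp [e1, e2]
      · exact Dvd.dvd.mul_left (pow_dvd_pow _ (Nat.mul_le_mul_left _ h)) _
    rw [Nat.mul_add, mul_one, pow_add, mul_comm] at h1
    exact (mul_dvd_mul_iff_right (pow_ne_zero _ X_ne_zero)).1 h1
  have hdvd2 : X ^ r ∣ (a k) ^ 2 - (b k) ^ 2 * (D * expand F r D) := by
    have : (a k) ^ 2 - (b k) ^ 2 * (D * expand F r D) =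
        (a k + b k * D ^ ((r + 1) / 2)) * (a k - b k * D ^ ((r + 1) / 2)) := by
      have h3 : (D ^ ((r + 1) / 2)) ^ 2 = D * expand F r D := by
        rw [← hDr, ← pow_mul, ← pow_succ']
        congr 1
        obtain ⟨m, rfl⟩ := hodd
        omega
      rw [← h3]; ring
    rw [this]
    exact Dvd.dvd.mul_right hdvd _
  have hdvd3 : X ^ r ∣ expand F r D - C (D.eval 0) := by
    have : (X : F[X]) ∣ D - C (D.eval 0) := by
      rw [X_dvd_iff]; simp [coeff_zero_eq_eval_zero]
    have := map_dvd (expand F r) this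
    simpa using this
  have hdvd4 : X ^ r ∣ (a k) ^ 2 - C (D.eval 0) * D * (b k) ^ 2 := by
    have : (a k) ^ 2 - C (D.eval 0) * D * (b k) ^ 2 = ((a k) ^ 2 - (b k) ^ 2 * (D * expand F r D))
      + (expand F r D - C (D.eval 0)) * (b k ^ 2 * D) := by ring
    rw [this]
    exact dvd_add hdvd2 (Dvd.dvd.mul_right hdvd3 _)
  have hz : (a k) ^ 2 - C (D.eval 0) * D * (b k) ^ 2 = 0 := by
    apply Polynomial.eq_zero_of_dvd_of_natDegree_lt hdvd4
    rw [natDegree_X_pow]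
    apply lt_of_le_of_lt (natDegree_sub_le _ _)
    apply max_lt
    · rw [natDegree_pow]; exact ha k
    · refine lt_of_le_of_lt (natDegree_mul_le) ?_
      have h5 := natDegree_C_mul_le (D.eval 0) D
      have h6 := natDegree_pow (b k) 2
      have := hb k
      omega
  exact hsq _ _ (sub_eq_zero.1 hz)

theorem stepanov {F : Type*} [Field F] [Fintype F] [DecidableEq F] (p : ℕ) [Fact p.Prime] [CharP F p]
    (μ r e : ℕ) (hμ : r = p ^ μ) (hodd : Odd r) (hcard : Fintype.card F = r ^ 2)
    (D : F[X]) (hDr : D ^ r = expand F r D) (hdeg : D.natDegree ≤ 2 * e) (he : 1 ≤ e)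
    (hre : 2 * e + 1 < r)
    (hsq : ∀ a b : F[X], a ^ 2 = C (D.eval 0) * D * b ^ 2 → a = 0 ∧ b = 0) :
    2 * (Finset.univ.filter (fun y : F => D.eval y ^ ((r ^ 2 - 1) / 2) = -1)).card
      ≤ r ^ 2 + 4 * e * r := by
  obtain ⟨s, hs⟩ := hodd
  have hr : 0 < r := by omega
  set L := s + 1 with hL
  set L' := s + 1 - e with hL'
  set M := s + e with hM
  set n := r * s + e + M with hn
  let θ : ((Fin M → degreeLT F L) × (Fin M → degreeLT F L')) →ₗ[F] F[X] :=
    { toFun := fun v => ∑ k : Fin M, (expand F r (v.1 k : F[X]) - expand F r (v.2 k : F[X]) * D ^ ((r + 1) / 2)) * X ^ (k : ℕ)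
      map_add' := by
        intro v w
        rw [← Finset.sum_add_distrib]
        refine Finset.sum_congr rfl fun k _ => ?_
        simp only [Prod.fst_add, Prod.snd_add, Pi.add_apply, Submodule.coe_add, map_add]
        ring
      map_smul' := by
        intro c v
        rw [Finset.smul_sum]
        refine Finset.sum_congr rfl fun k _ => ?_
        simp only [Prod.smul_fst, Prod.smul_snd, Pi.smul_apply, Submodule.coe_smul, RingHom.id_apply,
          smul_eq_C_mul, map_mul, expand_C]
        ring }
  have natdeg : ∀ {l : ℕ} (x : degreeLT F l), (x : F[X]).natDegree ≤ l - 1 := by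
    intro l x
    have h := mem_degreeLT.1 x.2
    by_cases hx : (x : F[X]) = 0
    · simp [hx]
    · have := (natDegree_lt_iff_degree_lt hx).2 h
      omega
  have hE : (D ^ ((r + 1) / 2)).natDegree ≤ e * (r + 1) := by
    refine natDegree_pow_le.trans ?_
    calc (r + 1) / 2 * D.natDegree ≤ (r + 1) / 2 * (2 * e) := Nat.mul_le_mul_left _ hdeg
      _ = e * (2 * ((r + 1) / 2)) := by ring
      _ ≤ e * (r + 1) := Nat.mul_le_mul_left _ (Nat.mul_div_le _ _)
  have hθ : ∀ v, θ v ∈ degreeLT F n := by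
    intro v
    change (∑ k : Fin M, (expand F r (v.1 k : F[X]) - expand F r (v.2 k : F[X]) * D ^ ((r + 1) / 2)) * X ^ (k : ℕ)) ∈ degreeLT F n
    apply Submodule.sum_mem
    intro k _
    rw [mem_degreeLT]
    refine lt_of_le_of_lt degree_le_natDegree ?_
    have hk := k.2
    norm_cast
    refine lt_of_le_of_lt natDegree_mul_le ?_
    rw [natDegree_X_pow]
    have h1 : (expand F r (v.1 k : F[X]) - expand F r (v.2 k : F[X]) * D ^ ((r + 1) / 2)).natDegree ≤ r * s + e := by
      refine (natDegree_sub_le _ _).trans (max_le ?_ ?_)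
      · rw [natDegree_expand]
        have := natdeg (v.1 k)
        calc _ ≤ (L - 1) * r := Nat.mul_le_mul_right _ this
          _ ≤ r * s + e := by simp only [hL, Nat.add_sub_cancel]; linarith [mul_comm s r]
      · refine natDegree_mul_le.trans ?_
        rw [natDegree_expand]
        have := natdeg (v.2 k)
        have h2 : (L' - 1) * r + e * (r + 1) = r * s + e := by
          have : L' - 1 + e = s := by omega
          rw [← this]; ring
        calc _ ≤ (L' - 1) * r + e * (r + 1) := Nat.add_le_add (Nat.mul_le_mul_right _ this) hE
          _ ≤ _ := h2.le
    omega
  let θ' := θ.codRestrict (degreeLT F n) hθ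
  have hfin : ∀ l : ℕ, Module.finrank F (degreeLT F l) = l := by
    intro l
    rw [(degreeLTEquiv F l).finrank_eq]; simp
  have : ∀ l, Module.Finite F (degreeLT F l) := fun l => Module.Finite.equiv (degreeLTEquiv F l).symm
  have hker : LinearMap.ker θ' ≠ ⊥ := by
    apply LinearMap.ker_ne_bot_of_finrank_lt
    rw [hfin, Module.finrank_prod, Module.finrank_pi_fintype, Module.finrank_pi_fintype]
    simp only [hfin, Finset.sum_const, Finset.card_univ, Fintype.card_fin, smul_eq_mul]
    obtain ⟨f, hf⟩ : ∃ f, s = e + 1 + f := ⟨s - (e + 1), by omega⟩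
    have e1 : L' = f + 2 := by omega
    have e2 : L = e + 2 + f := by omega
    have e3 : M = 2 * e + 1 + f := by omega
    have e4 : r = 2 * e + 2 * f + 3 := by omega
    rw [hn, e1, e2, e3, e4, hf]
    ring_nf
    nlinarith [Nat.zero_le (e * f), Nat.zero_le (e*e), Nat.zero_le (f*f)]
  obtain ⟨v, hv, hv0⟩ := Submodule.exists_mem_ne_zero_of_ne_bot hker
  have hv1 : θ v = 0 := by
    have := congrArg Subtype.val (LinearMap.mem_ker.1 hv)
    simpa [θ'] using this
  -- Frobenius twist
  let φ : F →+* F := iterateFrobenius F p μ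
  have hφ : ∀ x : F, φ x = x ^ r := by
    intro x; simp [φ, iterateFrobenius_def, hμ]
  let a : ℕ → F[X] := fun k => if h : k < M then (v.1 ⟨k, h⟩ : F[X]).map φ else 0
  let b : ℕ → F[X] := fun k => if h : k < M then (v.2 ⟨k, h⟩ : F[X]).map φ else 0
  have ha : ∀ k, (a k).natDegree ≤ s := by
    intro k
    simp only [a]; split_ifs with h
    · exact natDegree_map_le.trans ((natdeg _).trans (by omega))
    · simp
  have hb : ∀ k, (b k).natDegree + e ≤ s := by
    intro k
    simp only [b]; split_ifs with h
    · have := (natDegree_map_le (f := φ) (p := (v.2 ⟨k, h⟩ : F[X]))).trans (natdeg _)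
      omega
    · simp; omega
  set h := ∑ k ∈ Finset.range M, (a k + b k * D ^ ((r + 1) / 2)) * X ^ (r * k) with hh
  have hne : h ≠ 0 := by
    intro h0
    have hall := stp_indep D hr hDr ⟨s, hs⟩ e hdeg hsq a b (fun k => by have := ha k; omega)
      (fun k => by have := hb k; omega) h0
    apply hv0
    have hinj := Polynomial.map_injective φ φ.injective
    ext k : 3
    · have := (hall k k.2).1
      simp only [a, k.2, dif_pos] at this
      exact hinj (by simpa using this)
    · have := (hall k k.2).2
      simp only [b, k.2, dif_pos] at this
      exact hinj (by simpa using this)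
  have hdegh : h.natDegree ≤ s - e + e * (r + 1) + r * (M - 1) := by
    apply natDegree_sum_le_of_forall_le
    intro k hk
    rw [Finset.mem_range] at hk
    refine natDegree_mul_le.trans ?_
    rw [natDegree_X_pow]
    apply Nat.add_le_add
    · refine (natDegree_add_le _ _).trans (max_le ?_ ?_)
      · have := ha k
        have : e ≤ e * (r + 1) := Nat.le_mul_of_pos_right _ (by omega)
        omega
      · refine natDegree_mul_le.trans (Nat.add_le_add ?_ hE)
        have := hb k; omega
    · exact Nat.mul_le_mul_left _ (by omega)
  have hroot : ∀ y : F, D.eval y ^ ((r ^ 2 - 1) / 2) = -1 → h.eval y = 0 := by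
    intro y hy
    have hq : ∀ x : F, (x ^ r) ^ r = x := by
      intro x
      rw [← pow_mul, ← sq, ← hcard]; exact FiniteField.pow_card x
    have hz : (h.eval y) ^ r = 0 := by
      have e1 : (h.eval y) ^ r = (θ v).eval y := by
        rw [← hφ, hh, eval_finsetSum, map_sum, ← Fin.sum_univ_eq_sum_range (fun k => φ (eval y ((a k + b k * D ^ ((r + 1) / 2)) * X ^ (r * k))))]
        simp only [θ, LinearMap.coe_mk, AddHom.coe_mk, eval_finsetSum]
        refine Finset.sum_congr rfl fun k _ => ?_
        have eva : ∀ f : F[X], φ (eval y (f.map φ)) = eval (y ^ r) f := by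
          intro f
          have hcomp : φ.comp φ = RingHom.id F := by
            ext x; simp [hφ, hq]
          rw [← Polynomial.eval_map_apply, Polynomial.map_map, hcomp, Polynomial.map_id, hφ]
        simp only [eval_mul, eval_add, eval_sub, eval_pow, eval_X, map_mul, map_add, expand_eval, a, b, k.2, dif_pos, eva, Fin.eta, map_pow]
        have e2 : φ (eval y D) ^ ((r + 1) / 2) = - eval y D ^ ((r + 1) / 2) := by
          rw [hφ, ← pow_mul]
          have : r * ((r + 1) / 2) = (r ^ 2 - 1) / 2 + (r + 1) / 2 := by
            have h1 : (r + 1) / 2 = s + 1 := by omega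
            have h2 : (r ^ 2 - 1) / 2 = 2 * s ^ 2 + 2 * s := by
              have : r ^ 2 - 1 = 2 * (2 * s ^ 2 + 2 * s) := by
                rw [hs]; ring_nf; omega
              omega
            rw [h1, h2, hs]; ring
          rw [this, pow_add, hy]; ring
        have e3 : φ y ^ (r * (k : ℕ)) = y ^ (k : ℕ) := by
          rw [hφ, pow_mul, hq]
        rw [e2, e3]; ring
      rw [e1, hv1, eval_zero]
    exact eq_zero_of_pow_eq_zero hz
  have hcardle : (Finset.univ.filter (fun y : F => D.eval y ^ ((r ^ 2 - 1) / 2) = -1)).card ≤ h.natDegree := by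
    refine le_trans (Finset.card_le_card ?_) ((Multiset.toFinset_card_le h.roots).trans (card_roots' h))
    intro y hy
    rw [Finset.mem_filter] at hy
    rw [Multiset.mem_toFinset, mem_roots hne]
    exact hroot y hy.2
  have hfinal : 2 * (s - e + e * (r + 1) + r * (M - 1)) ≤ r ^ 2 + 4 * e * r := by
    obtain ⟨f, hf⟩ : ∃ f, s = e + 1 + f := ⟨s - (e + 1), by omega⟩
    have e1 : s - e = f + 1 := by omega
    have e3 : M - 1 = 2 * e + f := by omega
    have e4 : r = 2 * e + 2 * f + 3 := by omega
    rw [e1, e3, e4]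
    nlinarith [Nat.zero_le (e * f), Nat.zero_le (e*e), Nat.zero_le (f*f)]
  omega


theorem sqfree_aux {F : Type*} [Field F] (D : F[X]) (hD : Squarefree D) (hu : ¬ IsUnit D) (c : F) (hc : c ≠ 0)
    (a b : F[X]) (h : a ^ 2 = C c * D * b ^ 2) : a = 0 ∧ b = 0 := by
  by_cases hb : b = 0
  · subst hb
    simp at h
    exact ⟨h, rfl⟩
  exfalso
  have h1 : b ∣ a := by
    have : b ^ 2 ∣ a ^ 2 := ⟨C c * D, by rw [h]; ring⟩
    exact (IsIntegrallyClosed.pow_dvd_pow_iff two_ne_zero).1 this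
  obtain ⟨k, rfl⟩ := h1
  have h2 : k ^ 2 = C c * D := by
    have hb2 : b ^ 2 ≠ 0 := pow_ne_zero _ hb
    apply mul_left_cancel₀ hb2
    rw [← mul_pow, h]; ring
  have hcu : IsUnit (C c : F[X]) := isUnit_C.2 hc.isUnit
  have h3 : k * k ∣ D := by
    rw [← sq, h2]
    exact (hcu.mul_left_dvd).2 dvd_rfl
  have h4 := hD k h3
  apply hu
  have : IsUnit (C c * D) := by rw [← h2]; exact h4.pow 2
  exact isUnit_of_mul_isUnit_right this

theorem expand_aux {F : Type*} [Field F] (p : ℕ) [Fact p.Prime] [CharP F p] (μ : ℕ) (b : ℤ) :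
    ((X ^ p - X) ^ 2 - C ((4 * b : ℤ) : F)) ^ (p ^ μ) = expand F (p ^ μ) ((X ^ p - X) ^ 2 - C ((4 * b : ℤ) : F)) := by
  have h1 : (C ((4 * b : ℤ) : F)) ^ (p ^ μ) = C ((4 * b : ℤ) : F) := by
    rw [← C_pow, ← iterateFrobenius_def, map_intCast]
  have h2 : ((X ^ p - X : F[X]) ^ 2) ^ (p ^ μ) = ((X ^ (p ^ μ)) ^ p - X ^ (p ^ μ)) ^ 2 := by
    rw [pow_right_comm, sub_pow_char_pow, pow_right_comm X p]
  rw [sub_pow_char_pow, h1, h2, map_sub, map_pow, map_sub, map_pow, expand_X, expand_C]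

theorem kl_points {F : Type*} [Field F] [Fintype F] [DecidableEq F] (p : ℕ) [Fact p.Prime] [CharP F p]
    (hp2 : p ≠ 2) (μ r : ℕ) (hμ : r = p ^ μ) (hμ2 : 2 ≤ μ) (hcard : Fintype.card F = r ^ 2)
    (τ : F →+ ZMod p) (hτ : ∀ y, τ (y ^ p) = τ y) (b : ℤ) (hb : (b : F) ≠ 0) :
    r ^ 2 ≤ p * (Finset.univ.filter (fun x : F => x ≠ 0 ∧ τ (x + b / x) = 0)).card + 4 * p + 4 * p * r := by
  have hp := (Fact.out : p.Prime)
  have hpodd : Odd p := hp.odd_of_ne_two hp2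
  have hp3 : 3 ≤ p := by
    have := hp.two_le
    omega
  have hrodd : Odd r := hμ ▸ hpodd.pow
  have hre : 2 * p + 1 < r := by
    have : p ^ 2 ≤ r := hμ ▸ Nat.pow_le_pow_right (by omega) hμ2
    nlinarith
  have h2 : (2 : F) ≠ 0 := by
    apply Ring.two_ne_zero
    rw [ringChar.eq F p]; exact hp2
  have hchar : ringChar F ≠ 2 := by rw [ringChar.eq F p]; exact hp2
  set t : F[X] := X ^ p - X with ht
  set D : F[X] := t ^ 2 - C ((4 * b : ℤ) : F) with hD
  have h4b : ((4 * b : ℤ) : F) ≠ 0 := by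
    push_cast
    have : (4 : F) = 2 * 2 := by norm_num
    rw [this]
    exact mul_ne_zero (mul_ne_zero h2 h2) hb
  have hDr : D ^ r = expand F r D := by
    rw [hμ]; exact expand_aux p μ b
  have htdeg : t.natDegree = p := by
    rw [ht]; exact FiniteField.X_pow_card_sub_X_natDegree_eq F hp.one_lt
  have hDdeg : D.natDegree = 2 * p := by
    rw [hD, natDegree_sub_C, natDegree_pow, htdeg]
  have hderiv : derivative t = -1 := by
    rw [ht]; simp [derivative_X_pow]
  have hsep : D.Separable := by
    have hd : derivative D = -2 * t := by
      rw [hD, derivative_sub, derivative_C, derivative_pow, hderiv]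
      simp [show (C (2:F) : F[X]) = 2 from rfl]
    have hc : (C (-2 * ((4 * b : ℤ) : F)) : F[X]) * C ((-2 * ((4 * b : ℤ) : F))⁻¹) = 1 := by
      rw [← C_mul, mul_inv_cancel₀ (mul_ne_zero (neg_ne_zero.2 h2) h4b), C_1]
    refine ⟨2 * C ((-2 * ((4 * b : ℤ) : F))⁻¹), t * C ((-2 * ((4 * b : ℤ) : F))⁻¹), ?_⟩
    rw [hd, ← hc, hD, C_mul, C_neg, show (C (2:F) : F[X]) = 2 from rfl]
    ring
  have hnu : ¬ IsUnit D := by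
    intro h
    have := natDegree_eq_zero_of_isUnit h
    omega
  have hD0 : D.eval 0 ≠ 0 := by
    rw [hD, ht]
    simp only [eval_sub, eval_pow, eval_X, eval_C, zero_pow hp.ne_zero]
    simpa using h4b
  have hS := stepanov p μ r p hμ hrodd hcard D hDr hDdeg.le hp.one_le hre
    (fun a c h => sqfree_aux D hsep.squarefree hnu _ hD0 a c h)
  -- squares
  have hsplit : (Finset.univ : Finset F).card ≤
      (Finset.univ.filter (fun y : F => D.eval y = 0)).card +
      (Finset.univ.filter (fun y : F => D.eval y ^ ((r ^ 2 - 1) / 2) = -1)).card +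
      (Finset.univ.filter (fun y : F => D.eval y ≠ 0 ∧ IsSquare (D.eval y))).card := by
    refine le_trans (Finset.card_le_card ?_) (Finset.card_union_le _ _ |>.trans (Nat.add_le_add_right (Finset.card_union_le _ _) _))
    intro y _
    simp only [Finset.mem_union, Finset.mem_filter, Finset.mem_univ, true_and]
    by_cases h0 : D.eval y = 0
    · simp [h0]
    by_cases hs : IsSquare (D.eval y)
    · simp [h0, hs]
    · left; right
      have h5 := FiniteField.pow_dichotomy hchar h0
      have h6 := (FiniteField.isSquare_iff hchar h0).not.1 hs
      have h7 : (r ^ 2 - 1) / 2 = Fintype.card F / 2 := by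
        rw [hcard]
        obtain ⟨s, hs⟩ := hrodd.pow (n := 2)
        omega
      rw [h7]
      tauto
  have hzero : (Finset.univ.filter (fun y : F => D.eval y = 0)).card ≤ 2 * p := by
    rw [← hDdeg]
    have hDne : D ≠ 0 := by
      intro h; rw [h] at hDdeg; simp at hDdeg; omega
    refine le_trans (Finset.card_le_card ?_) ((Multiset.toFinset_card_le D.roots).trans (card_roots' D))
    intro y hy
    rw [Finset.mem_filter] at hy
    rw [Multiset.mem_toFinset, mem_roots hDne]
    exact hy.2
  have hcount : 2 * (Finset.univ.filter (fun y : F => D.eval y ≠ 0 ∧ IsSquare (D.eval y))).card ≤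
      p * (Finset.univ.filter (fun x : F => x ≠ 0 ∧ τ (x + b / x) = 0)).card := by
    calc 2 * (Finset.univ.filter (fun y : F => D.eval y ≠ 0 ∧ IsSquare (D.eval y))).card
        = ∑ y ∈ Finset.univ.filter (fun y : F => D.eval y ≠ 0 ∧ IsSquare (D.eval y)), 2 := by
          rw [Finset.sum_const, smul_eq_mul, mul_comm]
      _ ≤ ∑ y ∈ Finset.univ.filter (fun y : F => D.eval y ≠ 0 ∧ IsSquare (D.eval y)),
            (Finset.univ.filter (fun x : F => x ≠ 0 ∧ y ^ p - y = x + b / x)).card := by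
          apply Finset.sum_le_sum
          intro y hy
          rw [Finset.mem_filter] at hy
          obtain ⟨-, h0, z, hz⟩ := hy
          have hz0 : z ≠ 0 := by
            rintro rfl; apply h0; rw [hz]; ring
          have hzz : (y ^ p - y) ^ 2 - 4 * b = z * z := by
            rw [← hz, hD, ht]; simp
          have h4 : (4 : F) ≠ 0 := by
            rw [show (4 : F) = 2 * 2 by norm_num]; exact mul_ne_zero h2 h2
          set T := y ^ p - y with hT
          have hprod : ((T + z) / 2) * ((T - z) / 2) = b := by
            field_simp
            linear_combination hzz
          have hx1 : (T + z) / 2 ≠ 0 := fun h => hb (by rw [← hprod, h, zero_mul])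
          have hx2 : (T - z) / 2 ≠ 0 := fun h => hb (by rw [← hprod, h, mul_zero])
          have hne : (T + z) / 2 ≠ (T - z) / 2 := by
            intro h
            apply hz0
            field_simp at h
            have : 2 * z = 0 := by linear_combination h
            exact (mul_eq_zero.1 this).resolve_left h2
          rw [← Finset.card_pair hne]
          apply Finset.card_le_card
          intro x hx
          rw [Finset.mem_insert, Finset.mem_singleton] at hx
          rw [Finset.mem_filter]
          refine ⟨Finset.mem_univ _, ?_⟩
          rcases hx with rfl | rfl
          · refine ⟨hx1, ?_⟩
            rw [← hprod, mul_div_cancel_left₀ _ hx1]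
            field_simp; ring
          · refine ⟨hx2, ?_⟩
            rw [← hprod, mul_div_cancel_right₀ _ hx2]
            field_simp; ring
      _ ≤ ∑ y : F, (Finset.univ.filter (fun x : F => x ≠ 0 ∧ y ^ p - y = x + b / x)).card :=
          Finset.sum_le_sum_of_subset (Finset.filter_subset _ _)
      _ = ∑ x : F, (Finset.univ.filter (fun y : F => x ≠ 0 ∧ y ^ p - y = x + b / x)).card := by
          simp only [Finset.card_filter]
          rw [Finset.sum_comm]
      _ ≤ ∑ x : F, if x ≠ 0 ∧ τ (x + b / x) = 0 then p else 0 := by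
          apply Finset.sum_le_sum
          intro x _
          split_ifs with hx
          · have hpoly : (t - C (x + b / x)).natDegree = p := by
              rw [natDegree_sub_C, htdeg]
            have hne : t - C (x + b / x) ≠ 0 := by
              intro h; rw [h] at hpoly; simp at hpoly; omega
            conv_rhs => rw [← hpoly]
            refine le_trans (Finset.card_le_card ?_) ((Multiset.toFinset_card_le _).trans (card_roots' (t - C (x + b / x))))
            intro y hy
            rw [Finset.mem_filter] at hy
            rw [Multiset.mem_toFinset, mem_roots hne]
            simp [ht, IsRoot, hy.2.2]
          · rw [Nat.le_zero, Finset.card_eq_zero, Finset.filter_eq_empty_iff]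
            rintro y - ⟨hx0, hy⟩
            apply hx
            refine ⟨hx0, ?_⟩
            rw [← hy, map_sub, hτ, sub_self]
      _ = _ := by
          rw [← Finset.sum_filter, Finset.sum_const, smul_eq_mul, mul_comm]
  rw [Finset.card_univ, hcard] at hsplit
  linarith


noncomputable def KSum {F : Type*} [Field F] [Fintype F] [DecidableEq F] (Φ : AddChar F ℂ) (b : ℤ) : ℂ :=
  ∑ x : F, if x = 0 then 0 else Φ (x + b / x)

theorem sum_sq_fib {k : Type*} [Field k] [Fintype k] [DecidableEq k] (h2 : ringChar k ≠ 2) (g : k → ℂ) :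
    ∑ v : k, g (v ^ 2) = ∑ w : k, ((quadraticChar k w : ℤ) + 1 : ℂ) * g w := by
  rw [← Finset.sum_fiberwise_of_maps_to (s := Finset.univ) (t := Finset.univ) (g := fun v : k => v ^ 2)
    (fun _ _ => Finset.mem_univ _)]
  refine Finset.sum_congr rfl fun w _ => ?_
  have h := quadraticChar_card_sqrts h2 w
  rw [Finset.sum_congr rfl (g := fun _ => g w), Finset.sum_const, nsmul_eq_mul]
  · congr 1
    have h3 : ((Finset.univ.filter (fun v : k => v ^ 2 = w)).card : ℤ) = quadraticChar k w + 1 := by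
      rw [← h]; congr 2; ext; simp
    exact_mod_cast congrArg (fun z : ℤ => (z : ℂ)) h3
  · intro x hx
    rw [Finset.mem_filter] at hx
    rw [hx.2]

theorem sum_sq_twist {k : Type*} [Field k] [Fintype k] [DecidableEq k] (h2 : ringChar k ≠ 2)
    (ε : k) (hε : quadraticChar k ε = -1) (g : k → ℂ) :
    ∑ v : k, g (v ^ 2) + ∑ v : k, g (ε * v ^ 2) = 2 * ∑ w : k, g w := by
  have hε0 : ε ≠ 0 := by rintro rfl; simp at hε
  rw [sum_sq_fib h2 g, sum_sq_fib h2 (fun w => g (ε * w))]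
  have : ∑ w : k, ((quadraticChar k w : ℤ) + 1 : ℂ) * g (ε * w) =
      ∑ w : k, (-(quadraticChar k w : ℤ) + 1 : ℂ) * g w := by
    rw [← Equiv.sum_comp (Equiv.mulLeft₀ ε hε0) (fun w => (-(quadraticChar k w : ℤ) + 1 : ℂ) * g w)]
    refine Finset.sum_congr rfl fun w _ => ?_
    simp only [Equiv.mulLeft₀_apply, map_mul, hε]
    push_cast; ring
  rw [this, ← Finset.sum_add_distrib, Finset.mul_sum]
  refine Finset.sum_congr rfl fun w _ => ?_
  ring

theorem quad_core {k : Type*} [Field k] [Fintype k] [DecidableEq k] (h2 : ringChar k ≠ 2)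
    (ε : k) (hε : quadraticChar k ε = -1) (Φ : AddChar k ℂ) (hΦ : Φ ≠ 1) (b : ℤ) (hb : (b : k) ≠ 0) :
    KSum Φ b ^ 2 + ∑ u : k, ∑ v : k, (if u ^ 2 = ε * v ^ 2 then 0 else
      Φ (2 * u * (1 + b / (u ^ 2 - ε * v ^ 2)))) = 2 * (Fintype.card k : ℂ) := by
  have h20 : (2 : k) ≠ 0 := Ring.two_ne_zero h2
  let G : k → k → ℂ := fun u w => if u ^ 2 = w then 0 else Φ (2 * u * (1 + b / (u ^ 2 - w)))
  have e1 : KSum Φ b ^ 2 = ∑ u : k, ∑ v : k, G u (v ^ 2) := by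
    rw [sq, KSum, Finset.sum_mul_sum, ← Fintype.sum_prod_type', ← Fintype.sum_prod_type']
    let E : k × k ≃ k × k :=
      { toFun := fun z => (z.1 + z.2, z.1 - z.2)
        invFun := fun z => ((z.1 + z.2) / 2, (z.1 - z.2) / 2)
        left_inv := by rintro ⟨u, v⟩; ext <;> field_simp <;> ring
        right_inv := by rintro ⟨u, v⟩; ext <;> field_simp <;> ring }
    rw [← Equiv.sum_comp E]
    refine Finset.sum_congr rfl ?_
    rintro ⟨u, v⟩ _
    simp only [E, Equiv.coe_fn_mk, G]
    have hfac : u ^ 2 - v ^ 2 = (u + v) * (u - v) := by ring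
    by_cases h1 : u + v = 0
    · have hh : u ^ 2 = v ^ 2 := sub_eq_zero.1 (by rw [hfac, h1, zero_mul])
      rw [if_pos h1, zero_mul, if_pos hh]
    by_cases h3 : u - v = 0
    · have hh : u ^ 2 = v ^ 2 := sub_eq_zero.1 (by rw [hfac, h3, mul_zero])
      rw [if_pos h3, mul_zero, if_pos hh]
    have hh : ¬ u ^ 2 = v ^ 2 := fun h => mul_ne_zero h1 h3 (by rw [← hfac, h, sub_self])
    rw [if_neg h1, if_neg h3, if_neg hh,
      ← AddChar.map_add_eq_mul, hfac]
    congr 1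
    field_simp
    ring
  rw [e1, ← Finset.sum_add_distrib]
  have e2 : ∀ u : k, (∑ v : k, G u (v ^ 2) + ∑ v : k, (if u ^ 2 = ε * v ^ 2 then 0 else
      Φ (2 * u * (1 + b / (u ^ 2 - ε * v ^ 2))))) = 2 * ∑ w : k, G u w :=
    fun u => sum_sq_twist h2 ε hε (G u)
  rw [Finset.sum_congr rfl (fun u _ => e2 u), ← Finset.mul_sum]
  congr 1
  have e3 : ∀ u : k, ∑ w : k, G u w = ∑ n : k, if n = 0 then 0 else Φ (u * (2 * (1 + b / n))) := by
    intro u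
    rw [← Equiv.sum_comp (Equiv.subLeft (u ^ 2))]
    refine Finset.sum_congr rfl fun n _ => ?_
    simp only [G, Equiv.subLeft_apply]
    have : (u ^ 2 = u ^ 2 - n) ↔ n = 0 := by
      constructor
      · intro h; linear_combination h
      · rintro rfl; ring
    simp only [this]
    congr 2
    rw [sub_sub_cancel]; ring
  rw [Finset.sum_congr rfl (fun u _ => e3 u), Finset.sum_comm]
  have e4 : ∀ n : k, (∑ u : k, if n = 0 then 0 else Φ (u * (2 * (1 + b / n)))) =
      if n = -b then (Fintype.card k : ℂ) else 0 := by
    intro n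
    by_cases hn : n = 0
    · rw [if_neg (by rw [hn]; intro h; exact hb (by simpa using h.symm))]
      simp [hn]
    · simp only [hn, if_false]
      rw [AddChar.sum_mulShift _ (AddChar.IsPrimitive.of_ne_one hΦ)]
      have : (2 * (1 + b / n) = 0) ↔ n = -b := by
        rw [mul_eq_zero, or_iff_right h20]
        field_simp
        exact ⟨fun h => by linear_combination h, fun h => by rw [h]; ring⟩
      simp [this]
  rw [Finset.sum_congr rfl (fun n _ => e4 n)]
  simp

theorem ksum_real {F : Type*} [Field F] [Fintype F] [DecidableEq F] (Φ : AddChar F ℂ) (b : ℤ) :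
    (starRingEnd ℂ) (KSum Φ b) = KSum Φ b := by
  rw [KSum, map_sum, ← Equiv.sum_comp (Equiv.neg F)]
  refine Finset.sum_congr rfl fun x _ => ?_
  simp only [Equiv.neg_apply, neg_eq_zero]
  split_ifs with h
  · simp
  · rw [← AddChar.map_neg_eq_conj]
    congr 1
    field_simp
    ring

/-- tower statement -/
theorem tower (p : ℕ) [Fact p.Prime] (hp2 : p ≠ 2) (b : ℤ) (hb : (b : ZMod p) ≠ 0)
    (T : ℕ → AddChar (ZMod p) ℂ → ℂ) (hT0 : ∀ ψ, T 0 ψ = KSum ψ b)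
    (hT : ∀ j ψ, T (j + 1) ψ = 2 * (p : ℂ) ^ (2 ^ j) - T j ψ ^ 2) (j : ℕ) :
    ∃ (K : Type) (_ : Field K) (_ : Fintype K) (_ : DecidableEq K) (_ : CharP K p) (τ : K →+ ZMod p),
      Fintype.card K = p ^ (2 ^ j) ∧ (∀ y, τ (y ^ p) = τ y) ∧ Function.Surjective τ ∧
      ∀ ψ : AddChar (ZMod p) ℂ, ψ ≠ 1 → KSum (ψ.compAddMonoidHom τ) b = T j ψ := by
  induction j with
  | zero =>
    refine ⟨ZMod p, inferInstance, inferInstance, inferInstance, inferInstance, AddMonoidHom.id _, ?_, ?_, ?_, ?_⟩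
    · simp [ZMod.card]
    · intro y; simp
    · exact Function.surjective_id
    · intro ψ _
      rw [hT0]; rfl
  | succ j ih =>
    obtain ⟨k, _, _, _, _, τ, hcard, hfrob, hsurj, hK⟩ := ih
    have hchar : ringChar k ≠ 2 := by rw [ringChar.eq k p]; exact hp2
    have h20 : (2 : k) ≠ 0 := Ring.two_ne_zero hchar
    obtain ⟨ε, hε⟩ := quadraticChar_exists_neg_one hchar
    have hε0 : ε ≠ 0 := by rintro rfl; simp at hε
    have hns := quadraticChar_neg_one_iff_not_isSquare.1 hε
    have hfact : Fact (∀ r : k, r ^ 2 ≠ ε + 0 * r) :=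
      ⟨fun r h => hns ⟨r, by rw [← sq, h]; ring⟩⟩
    let _ : Fintype (QuadraticAlgebra k ε 0) := Fintype.ofEquiv _ (QuadraticAlgebra.equivProd ε (0 : k)).symm
    let _ : DecidableEq (QuadraticAlgebra k ε 0) := Classical.decEq (QuadraticAlgebra k ε 0)
    have hinj := QuadraticAlgebra.algebraMap_injective (R := k) (a := ε) (b := 0)
    have hcharK : CharP (QuadraticAlgebra k ε 0) p := charP_of_injective_algebraMap hinj p
    let τK : (QuadraticAlgebra k ε 0) →+ ZMod p :=
      { toFun := fun z => τ (2 * z.re)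
        map_zero' := by simp
        map_add' := by intro x y; simp [mul_add] }
    have hbk : (b : k) ≠ 0 := by
      intro h
      apply hb
      rw [CharP.intCast_eq_zero_iff k p] at h
      rwa [CharP.intCast_eq_zero_iff (ZMod p) p]
    refine ⟨(QuadraticAlgebra k ε 0), inferInstance, inferInstance, inferInstance, hcharK, τK, ?_, ?_, ?_, ?_⟩
    · rw [Fintype.ofEquiv_card, Fintype.card_prod, hcard, ← pow_add]
      congr 1; rw [pow_succ]; ring
    · intro z
      change τ (2 * (z ^ p).re) = τ (2 * z.re)
      have hz : z = algebraMap k (QuadraticAlgebra k ε 0) z.re + algebraMap k (QuadraticAlgebra k ε 0) z.im * QuadraticAlgebra.omega := by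
        ext <;> simp
      obtain ⟨m, hm⟩ := (Fact.out : p.Prime).odd_of_ne_two hp2
      have hω : (QuadraticAlgebra.omega : (QuadraticAlgebra k ε 0)) ^ p = algebraMap k (QuadraticAlgebra k ε 0) (ε ^ m) * QuadraticAlgebra.omega := by
        have : (QuadraticAlgebra.omega : (QuadraticAlgebra k ε 0)) ^ 2 = algebraMap k (QuadraticAlgebra k ε 0) ε := by
          rw [sq]; ext <;> simp
        rw [hm, pow_succ, pow_mul, this, map_pow]
      have hre : (z ^ p).re = z.re ^ p := by
        conv_lhs => rw [hz]
        rw [add_pow_char, mul_pow, hω, ← map_pow, ← map_pow, ← mul_assoc, ← map_mul]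
        simp only [QuadraticAlgebra.re_add, QuadraticAlgebra.re_mul, QuadraticAlgebra.algebraMap_re, QuadraticAlgebra.algebraMap_im, QuadraticAlgebra.omega_re, QuadraticAlgebra.omega_im]
        ring
      rw [hre]
      have : (2 : k) * z.re ^ p = (2 * z.re) ^ p := by
        rw [mul_pow]
        congr 1
        rw [← frobenius_def, map_ofNat]
      rw [this, hfrob]
    · intro y
      obtain ⟨x, hx⟩ := hsurj y
      refine ⟨⟨x / 2, 0⟩, ?_⟩
      change τ (2 * (x / 2)) = y
      rw [mul_div_cancel₀ _ h20, hx]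
    · intro ψ hψ
      have hΦ : ψ.compAddMonoidHom τ ≠ 1 := by
        intro h
        apply hψ
        ext y
        obtain ⟨x, hx⟩ := hsurj y
        have := DFunLike.congr_fun h x
        simpa [hx] using this
      have hq := quad_core hchar ε hε _ hΦ b hbk
      rw [hK ψ hψ] at hq
      have hcc : ((Fintype.card k : ℕ) : ℂ) = (p : ℂ) ^ (2 ^ j) := by rw [hcard]; push_cast; rfl
      rw [hT, ← hcc, ← hq, add_sub_cancel_left, KSum, ← Fintype.sum_prod_type']
      rw [← Equiv.sum_comp (QuadraticAlgebra.equivProd ε (0 : k)).symm]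
      refine Finset.sum_congr rfl ?_
      rintro ⟨u, v⟩ _
      have hnorm : QuadraticAlgebra.norm ((⟨u, v⟩ : QuadraticAlgebra k ε 0)) = u ^ 2 - ε * v ^ 2 := by
        rw [QuadraticAlgebra.norm_def]; simp; ring
      have hz : ((⟨u, v⟩ : (QuadraticAlgebra k ε 0)) = 0) ↔ u ^ 2 = ε * v ^ 2 := by
        rw [← sub_eq_zero (a := u ^ 2), ← hnorm, QuadraticAlgebra.norm_eq_zero_iff_eq_zero]
      change (if (⟨u, v⟩ : (QuadraticAlgebra k ε 0)) = 0 then (0 : ℂ) else ψ (τ (2 * ((⟨u, v⟩ : (QuadraticAlgebra k ε 0)) + b / (⟨u, v⟩ : (QuadraticAlgebra k ε 0))).re))) = _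
      simp only [hz]
      split_ifs with h
      · rfl
      · simp only [AddChar.compAddMonoidHom_apply]
        congr 2
        have : ((⟨u, v⟩ : (QuadraticAlgebra k ε 0)) + b / (⟨u, v⟩ : (QuadraticAlgebra k ε 0))).re = u + b * (u / (u ^ 2 - ε * v ^ 2)) := by
          rw [div_eq_mul_inv, ← hnorm]
          simp [QuadraticAlgebra.inv_def, div_eq_inv_mul]
        rw [this]; ring



theorem weil_iter (y : ℕ → ℝ) (hy : ∀ j, y (j + 1) = (y j - 2) ^ 2) (B : ℝ) (hB : ∀ j, 1 ≤ j → y j ≤ B) :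
    y 0 ≤ 4 := by
  by_contra h
  push Not at h
  have key : ∀ j : ℕ, 4 + 4 ^ j * (y 0 - 4) ≤ y j := by
    intro j
    induction j with
    | zero => simp
    | succ j ih =>
      rw [hy, pow_succ]
      have : (0 : ℝ) < 4 ^ j * (y 0 - 4) := mul_pos (by positivity) (by linarith)
      nlinarith
  have hδ : 0 < y 0 - 4 := by linarith
  obtain ⟨n, hn⟩ := exists_nat_gt ((B) / (y 0 - 4))
  have h1 := key (n + 1)
  have h2 := hB (n + 1) (by omega)
  rw [div_lt_iff₀ hδ] at hn
  have h3 : (n : ℝ) ≤ 4 ^ (n + 1) := by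
    have : n + 1 < 4 ^ (n + 1) := Nat.lt_pow_self (by norm_num)
    have : n ≤ 4 ^ (n + 1) := by omega
    exact_mod_cast this
  nlinarith

noncomputable def RT (p : ℕ) [Fact p.Prime] (b : ℤ) : ℕ → AddChar (ZMod p) ℂ → ℝ
  | 0, ψ => (KSum ψ b).re
  | j + 1, ψ => 2 * (p : ℝ) ^ (2 ^ j) - (RT p b j ψ) ^ 2

theorem weil_level (p : ℕ) [Fact p.Prime] (hp2 : p ≠ 2) (b : ℤ) (hb : (b : ZMod p) ≠ 0)
    (ψ : AddChar (ZMod p) ℂ) (hψ : ψ ≠ 1) (j : ℕ) (hj : 1 ≤ j) :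
    (RT p b j ψ) ^ 2 ≤ 10 * p * p ^ (2 ^ j) := by
  classical
  have hp0 : 0 < p := (Fact.out : p.Prime).pos
  obtain ⟨K, _, _, _, _, τ, hcard, hfrob, hsurj, hK⟩ := tower p hp2 b hb (fun j ψ => (RT p b j ψ : ℂ))
    (fun ψ => by
      simp only [RT]
      exact (Complex.conj_eq_iff_re.1 (ksum_real ψ b)))
    (fun j ψ => by simp only [RT]; push_cast; ring) (j + 1)
  set r := p ^ (2 ^ j) with hr
  have hcard' : Fintype.card K = r ^ 2 := by rw [hcard, hr, ← pow_mul, pow_succ]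
  have hμ2 : 2 ≤ 2 ^ j := by
    calc 2 = 2 ^ 1 := rfl
      _ ≤ 2 ^ j := Nat.pow_le_pow_right (by norm_num) hj
  have hbK : (b : K) ≠ 0 := by
    intro h
    apply hb
    rw [CharP.intCast_eq_zero_iff K p] at h
    rwa [CharP.intCast_eq_zero_iff (ZMod p) p]
  have hpts := kl_points p hp2 (2 ^ j) r hr hμ2 hcard' τ hfrob b hbK
  set M := (Finset.univ.filter (fun x : K => x ≠ 0 ∧ τ (x + b/x) = 0)).card with hM
  have hsum : ∑ χ : AddChar (ZMod p) ℂ, KSum (χ.compAddMonoidHom τ) b = (p * M : ℕ) := by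
    simp only [KSum]
    rw [Finset.sum_comm, hM, Finset.card_filter]
    push_cast
    rw [Finset.mul_sum]
    refine Finset.sum_congr rfl fun x _ => ?_
    by_cases hx : x = 0
    · simp [hx]
    · simp only [hx, if_false, AddChar.coe_compAddMonoidHom, Function.comp_apply]
      rw [AddChar.sum_apply_eq_ite]
      simp [hx, ZMod.card]
  have h1 : KSum ((1 : AddChar (ZMod p) ℂ).compAddMonoidHom τ) b = (r ^ 2 : ℂ) - 1 := by
    have : KSum ((1 : AddChar (ZMod p) ℂ).compAddMonoidHom τ) b = ∑ x : K, ((1 : ℂ) - if x = 0 then 1 else 0) := by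
      rw [KSum]
      refine Finset.sum_congr rfl fun x _ => ?_
      by_cases hx : x = 0 <;> simp [hx]
    rw [this, Finset.sum_sub_distrib]
    simp [hcard']
  rw [← Finset.add_sum_erase _ _ (Finset.mem_univ (1 : AddChar (ZMod p) ℂ)), h1,
    Finset.sum_congr rfl (g := fun χ => ((RT p b (j+1) χ : ℝ) : ℂ))
      (fun χ hχ => hK χ (Finset.ne_of_mem_erase hχ))] at hsum
  have hsum' : (r : ℝ) ^ 2 - 1 + ∑ χ ∈ (Finset.univ.erase (1 : AddChar (ZMod p) ℂ)), RT p b (j + 1) χ = p * M := by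
    exact_mod_cast hsum
  have hpts' : (r : ℝ) ^ 2 ≤ p * M + 4 * p + 4 * p * r := by exact_mod_cast hpts
  have hrr : (p : ℝ) ^ (2 ^ j) = r := by rw [hr]; push_cast; rfl
  have hsum2 : ∑ χ ∈ (Finset.univ.erase (1 : AddChar (ZMod p) ℂ)), RT p b (j + 1) χ =
      (p - 1 : ℝ) * (2 * r) - ∑ χ ∈ (Finset.univ.erase (1 : AddChar (ZMod p) ℂ)), (RT p b j χ) ^ 2 := by
    simp only [RT, Finset.sum_sub_distrib, hrr, Finset.sum_const, nsmul_eq_mul]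
    rw [Finset.card_erase_of_mem (Finset.mem_univ _), Finset.card_univ, AddChar.card_eq, ZMod.card,
      Nat.cast_sub hp0]
    simp
  have hle : (RT p b j ψ) ^ 2 ≤ ∑ χ ∈ (Finset.univ.erase (1 : AddChar (ZMod p) ℂ)), (RT p b j χ) ^ 2 :=
    Finset.single_le_sum (f := fun χ => (RT p b j χ) ^ 2) (fun χ _ => sq_nonneg _)
      (Finset.mem_erase.2 ⟨hψ, Finset.mem_univ _⟩)
  rw [hrr]
  have hr1 : (1 : ℝ) ≤ r := by
    have : 1 ≤ r := Nat.one_le_pow _ _ hp0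
    exact_mod_cast this
  have hp1 : (1 : ℝ) ≤ p := by exact_mod_cast hp0
  have : (p : ℝ) * 1 ≤ p * r := mul_le_mul_of_nonneg_left hr1 (by linarith)
  nlinarith

theorem weil_prime (p : ℕ) [Fact p.Prime] (hp2 : p ≠ 2) (b : ℤ) (hb : (b : ZMod p) ≠ 0)
    (ψ : AddChar (ZMod p) ℂ) (hψ : ψ ≠ 1) : ‖KSum ψ b‖ ≤ 2 * Real.sqrt p := by
  have hp0 : (0 : ℝ) < p := by exact_mod_cast (Fact.out : p.Prime).pos
  have h := weil_iter (fun j => (RT p b j ψ) ^ 2 / p ^ (2 ^ j)) (fun j => by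
    simp only [RT]
    have h0 : (p : ℝ) ^ (2 ^ j) ≠ 0 := by positivity
    have : (p : ℝ) ^ (2 ^ (j + 1)) = (p ^ (2 ^ j)) ^ 2 := by rw [← pow_mul, pow_succ]
    rw [this]
    field_simp
    ring) (10 * p) (fun j hj => by
      rw [div_le_iff₀ (by positivity)]
      exact weil_level p hp2 b hb ψ hψ j hj)
  simp only [RT, pow_zero, pow_one] at h
  rw [div_le_iff₀ hp0] at h
  have hre : KSum ψ b = ((KSum ψ b).re : ℂ) := (Complex.conj_eq_iff_re.1 (ksum_real ψ b)).symm
  rw [hre, Complex.norm_real, Real.norm_eq_abs]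
  apply abs_le_of_sq_le_sq _ (by positivity)
  rw [mul_pow, Real.sq_sqrt hp0.le]
  linarith


noncomputable def Kl (c : ℕ) [NeZero c] (m n : ℤ) : ℂ :=
  ∑ u : (ZMod c)ˣ, ZMod.stdAddChar ((m : ZMod c) * (u : ZMod c) + (n : ZMod c) * ((u⁻¹ : (ZMod c)ˣ) : ZMod c))

theorem std_norm (c : ℕ) [NeZero c] (x : ZMod c) : ‖ZMod.stdAddChar x‖ = 1 := by
  exact (ZMod.stdAddChar (N := c)).norm_apply x

theorem Kl_trivial (c : ℕ) [NeZero c] (m n : ℤ) : ‖Kl c m n‖ ≤ c := by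
  unfold Kl
  refine (norm_sum_le _ _).trans ?_
  simp only [std_norm, Finset.sum_const, nsmul_eq_mul, mul_one, Finset.card_univ,
    ZMod.card_units_eq_totient]
  exact_mod_cast Nat.totient_le c

theorem std_crt (c1 c2 : ℕ) [NeZero c1] [NeZero c2] (h : c1.Coprime c2) (r s : ℤ) (hrs : r * c2 + s * c1 = 1)
    (x : ZMod (c1 * c2)) :
    ZMod.stdAddChar x = ZMod.stdAddChar ((r : ZMod c1) * (ZMod.chineseRemainder h x).1) *
      ZMod.stdAddChar ((s : ZMod c2) * (ZMod.chineseRemainder h x).2) := by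
  obtain ⟨j, rfl⟩ := ZMod.intCast_surjective x
  rw [map_intCast (ZMod.chineseRemainder h) j]
  simp only [Prod.fst_intCast, Prod.snd_intCast]
  rw [← Int.cast_mul, ← Int.cast_mul, ZMod.stdAddChar_coe, ZMod.stdAddChar_coe, ZMod.stdAddChar_coe,
    ← Complex.exp_add]
  congr 1
  have h1 : (c1 : ℂ) ≠ 0 := by exact_mod_cast NeZero.ne c1
  have h2 : (c2 : ℂ) ≠ 0 := by exact_mod_cast NeZero.ne c2
  have h3 : (r : ℂ) * c2 + s * c1 = 1 := by exact_mod_cast hrs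
  push_cast
  field_simp
  linear_combination (-(j : ℂ)) * h3

theorem Kl_crt (c1 c2 : ℕ) [NeZero c1] [NeZero c2] (h : c1.Coprime c2) (r s : ℤ) (hrs : r * c2 + s * c1 = 1)
    (m n : ℤ) : Kl (c1 * c2) m n = Kl c1 (r * m) (r * n) * Kl c2 (s * m) (s * n) := by
  unfold Kl
  rw [Finset.sum_mul_sum, ← Fintype.sum_prod_type']
  rw [← Equiv.sum_comp ((Units.mapEquiv (ZMod.chineseRemainder h).toMulEquiv).trans MulEquiv.prodUnits).toEquiv]
  refine Finset.sum_congr rfl fun u _ => ?_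
  rw [std_crt c1 c2 h r s hrs]
  simp only [map_add, map_mul, map_intCast]
  congr 2
  · simp only [Prod.fst_add, Prod.fst_mul, Prod.fst_intCast]
    push_cast
    rw [mul_add, ← mul_assoc, ← mul_assoc]
    rfl
  · simp only [Prod.snd_add, Prod.snd_mul, Prod.snd_intCast]
    push_cast
    rw [mul_add, ← mul_assoc, ← mul_assoc]
    rfl

theorem sum_units {F : Type*} [Field F] [Fintype F] [DecidableEq F] (f : F → ℂ) :
    ∑ u : Fˣ, f u = ∑ x : F, if x = 0 then 0 else f x := by
  have : ∑ x : F, (if x = 0 then 0 else f x) = ∑ x ∈ Finset.univ.filter (fun x : F => x ≠ 0), f x := by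
    rw [Finset.sum_filter]
    refine Finset.sum_congr rfl fun x _ => ?_
    by_cases hx : x = 0 <;> simp [hx]
  rw [this]
  refine Finset.sum_bij (fun u _ => (u : F)) ?_ ?_ ?_ ?_
  · intro u _; simp
  · intro u _ v _ h; exact Units.ext h
  · intro x hx
    simp only [Finset.mem_filter, Finset.mem_univ, true_and] at hx
    exact ⟨Units.mk0 x hx, Finset.mem_univ _, rfl⟩
  · intro u _; rfl

theorem Kl_prime (p : ℕ) [Fact p.Prime] (m n : ℤ) :
    ‖Kl p m n‖ ^ 2 ≤ 4 * p * (Int.gcd n p : ℝ) := by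
  have hp : p.Prime := Fact.out
  have hp1 : (1 : ℝ) ≤ p := by exact_mod_cast hp.one_lt.le
  have hg1 : (1 : ℝ) ≤ Int.gcd n p := by
    have : 0 < Int.gcd n p := Int.gcd_pos_of_ne_zero_right _ (by exact_mod_cast hp.ne_zero)
    exact_mod_cast this
  have hne : (ZMod.stdAddChar : AddChar (ZMod p) ℂ) ≠ 1 := by
    intro h
    have := ZMod.injective_stdAddChar (N := p) (a₁ := 0) (a₂ := 1) (by rw [h]; simp)
    exact zero_ne_one this
  by_cases hn : (n : ZMod p) = 0
  · have : (p : ℤ) ∣ n := (ZMod.intCast_zmod_eq_zero_iff_dvd n p).1 hn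
    have hg : Int.gcd n p = p := by
      rw [Int.gcd_comm, Int.gcd_eq_natAbs_left this]; simp
    rw [hg]
    have := Kl_trivial p m n
    nlinarith [norm_nonneg (Kl p m n)]
  by_cases hm : (m : ZMod p) = 0
  · have : Kl p m n = -1 := by
      unfold Kl
      simp only [hm, zero_mul, zero_add]
      rw [← Equiv.sum_comp (Equiv.inv (ZMod p)ˣ)]
      simp only [Equiv.inv_apply, inv_inv]
      rw [sum_units (fun x : ZMod p => ZMod.stdAddChar ((n : ZMod p) * x))]
      have h0 : ∑ x : ZMod p, ZMod.stdAddChar ((n : ZMod p) * x) = 0 := by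
        have := AddChar.sum_mulShift (R' := ℂ) (n : ZMod p) (ZMod.isPrimitive_stdAddChar p)
        rw [if_neg hn] at this
        simpa [mul_comm] using this
      have h1 : ∑ x : ZMod p, (if x = 0 then (0:ℂ) else ZMod.stdAddChar ((n : ZMod p) * x)) =
        ∑ x : ZMod p, (ZMod.stdAddChar ((n : ZMod p) * x) - if x = 0 then 1 else 0) := by
        refine Finset.sum_congr rfl fun x _ => ?_
        by_cases hx : x = 0 <;> simp [hx]
      rw [h1, Finset.sum_sub_distrib, h0]
      simp
    rw [this]
    simp only [norm_neg, norm_one, one_pow]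
    nlinarith
  by_cases hp2 : p = 2
  · subst hp2
    have h1 : ‖Kl 2 m n‖ ≤ 1 := by
      unfold Kl
      refine (norm_sum_le _ _).trans ?_
      simp only [std_norm, Finset.sum_const, nsmul_eq_mul, mul_one, Finset.card_univ,
        ZMod.card_units_eq_totient]
      simp
    have h0 := norm_nonneg (Kl 2 m n)
    have h2 : ‖Kl 2 m n‖ ^ 2 ≤ 1 := by nlinarith
    push_cast at hg1 ⊢
    linarith
  have hK : Kl p m n = KSum (ZMod.stdAddChar : AddChar (ZMod p) ℂ) (m * n) := by
    unfold Kl KSum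
    rw [← sum_units (fun x : ZMod p => ZMod.stdAddChar (x + ((m * n : ℤ) : ZMod p) / x))]
    rw [← Equiv.sum_comp (Equiv.mulLeft (Units.mk0 (m : ZMod p) hm))
      (fun u : (ZMod p)ˣ => ZMod.stdAddChar ((u : ZMod p) + ((m * n : ℤ) : ZMod p) / (u : ZMod p)))]
    refine Finset.sum_congr rfl fun u _ => ?_
    congr 1
    simp only [Equiv.coe_mulLeft, Units.val_mul, Units.val_mk0, Units.val_inv_eq_inv_val]
    push_cast
    field_simp
  rw [hK]
  have := weil_prime p hp2 (m * n) (by push_cast; exact mul_ne_zero hm hn) _ hne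
  have h2 : ‖KSum (ZMod.stdAddChar : AddChar (ZMod p) ℂ) (m * n)‖ ^ 2 ≤ 4 * p := by
    calc _ ≤ (2 * Real.sqrt p) ^ 2 := by gcongr
      _ = 4 * p := by rw [mul_pow, Real.sq_sqrt (by linarith)]; ring
  nlinarith

theorem Kl_bound (c : ℕ) : c ≠ 0 → ∃ s t : ℕ, 0 < s ∧ 0 < t ∧ s ^ 2 * t ^ 3 ∣ c ∧
    ∀ [NeZero c] (m n : ℤ), ‖Kl c m n‖ ^ 2 ≤ (c.divisors.card : ℝ) ^ 2 * c * (Int.gcd n c) * (s ^ 2 * t ^ 3) := by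
  induction c using Nat.recOnPosPrimePosCoprime with
  | zero => intro h; exact absurd rfl h
  | one =>
    intro _
    refine ⟨1, 1, one_pos, one_pos, by simp, fun m n => ?_⟩
    have := Kl_trivial 1 m n
    have h0 := norm_nonneg (Kl 1 m n)
    simp
    push_cast at this
    nlinarith
  | prime_pow p k hp hk =>
    intro hne
    have triv : ∀ [NeZero (p ^ k)] (m n : ℤ), ‖Kl (p ^ k) m n‖ ^ 2 ≤
        (((p ^ k).divisors.card : ℕ) : ℝ) ^ 2 * (p ^ k : ℕ) * (Int.gcd n (p ^ k : ℕ)) * (p ^ k : ℕ) := by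
      intro _ m n
      have h1 : (1 : ℝ) ≤ ((p ^ k).divisors.card : ℕ) := by
        have : 0 < (p ^ k).divisors.card := Finset.card_pos.2 (Nat.nonempty_divisors.2 hne)
        exact_mod_cast this
      have h2 : (1 : ℝ) ≤ Int.gcd n (p ^ k : ℕ) := by
        have : 0 < Int.gcd n (p ^ k : ℕ) := Int.gcd_pos_of_ne_zero_right _ (by exact_mod_cast hne)
        exact_mod_cast this
      have h3 := Kl_trivial (p ^ k) m n
      calc ‖Kl (p ^ k) m n‖ ^ 2 ≤ ((p ^ k : ℕ) : ℝ) ^ 2 := by gcongr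
        _ = (1 : ℝ) ^ 2 * ((p ^ k : ℕ) : ℝ) * 1 * ((p ^ k : ℕ) : ℝ) := by ring
        _ ≤ _ := by gcongr
    by_cases h1 : k = 1
    · subst h1
      refine ⟨1, 1, one_pos, one_pos, by simp, ?_⟩
      rw [pow_one]
      intro _ m n
      haveI : Fact p.Prime := ⟨hp⟩
      have := Kl_prime p m n
      rw [hp.divisors, Finset.card_pair hp.one_lt.ne]
      push_cast
      convert this using 1
      ring
    rcases Nat.even_or_odd' k with ⟨l, rfl | rfl⟩
    · refine ⟨p ^ l, 1, pow_pos hp.pos _, one_pos, ?_, ?_⟩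
      · rw [← pow_mul, mul_comm l]; simp
      · intro _ m n
        refine (triv m n).trans (le_of_eq ?_)
        push_cast
        ring
    · refine ⟨p ^ (l - 1), p, pow_pos hp.pos _, hp.pos, ?_, ?_⟩
      · rw [← pow_mul, ← pow_add]
        exact pow_dvd_pow _ (by omega)
      · intro _ m n
        refine (triv m n).trans (le_of_eq ?_)
        push_cast
        rw [← pow_mul, ← pow_add, show (l - 1) * 2 + 3 = 2 * l + 1 by omega]
  | coprime a b ha hb hab iha ihb =>
    intro _
    haveI : NeZero a := ⟨by omega⟩
    haveI : NeZero b := ⟨by omega⟩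
    obtain ⟨s1, t1, hs1, ht1, hd1, hB1⟩ := iha (by omega)
    obtain ⟨s2, t2, hs2, ht2, hd2, hB2⟩ := ihb (by omega)
    refine ⟨s1 * s2, t1 * t2, by positivity, by positivity, ?_, ?_⟩
    · have := Nat.mul_dvd_mul hd1 hd2
      convert this using 1
      ring
    · intro _ m n
      have hbez := Nat.gcd_eq_gcd_ab a b
      rw [hab] at hbez
      set s := Nat.gcdA a b
      set r := Nat.gcdB a b
      have hrs : r * b + s * a = 1 := by push_cast at hbez; linarith
      have hK := Kl_crt a b hab r s hrs m n
      have hK' : Kl (a * b) m n = Kl a (r * m) (r * n) * Kl b (s * m) (s * n) := by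
        convert hK
      rw [hK', norm_mul, mul_pow, Nat.Coprime.card_divisors_mul hab]
      have hg1 : Int.gcd (r * n) a = Int.gcd n a := by
        apply Int.gcd_mul_right_left_of_gcd_eq_one
        rw [← Int.isCoprime_iff_gcd_eq_one]
        exact ⟨b, s, by linarith⟩
      have hg2 : Int.gcd (s * n) b = Int.gcd n b := by
        apply Int.gcd_mul_right_left_of_gcd_eq_one
        rw [← Int.isCoprime_iff_gcd_eq_one]
        exact ⟨a, r, by linarith⟩
      have hg : Int.gcd n ((a * b : ℕ) : ℤ) = Int.gcd n a * Int.gcd n b := by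
        simp only [Int.gcd, Int.natAbs_natCast]
        exact Nat.Coprime.gcd_mul _ hab
      have e1 := hB1 (r * m) (r * n)
      have e2 := hB2 (s * m) (s * n)
      rw [hg1] at e1
      rw [hg2] at e2
      rw [hg]
      calc _ ≤ _ := mul_le_mul e1 e2 (by positivity) (by positivity)
        _ = _ := by push_cast; ring


theorem fourier_inv (c : ℕ) [NeZero c] (f : ZMod c → ℂ) (x : ZMod c) :
    f x = ∑ k : ZMod c, ((c : ℂ)⁻¹ * ZMod.dft f k) * ZMod.stdAddChar (k * x) := by
  have h := congrFun (ZMod.dft.symm_apply_apply f) x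
  rw [ZMod.invDFT_apply] at h
  rw [← h, Finset.smul_sum]
  refine Finset.sum_congr rfl fun k _ => ?_
  simp only [smul_eq_mul]
  ring

theorem completion (c : ℕ) [NeZero c] (f s : ZMod c → ℂ) (a1 a2 : ZMod c) (B : ZMod c → ℝ)
    (hB : ∀ (m : ℤ) (h : ZMod c), ‖Kl c m h.val‖ ≤ B h) :
    ‖∑ u : (ZMod c)ˣ, f u * (s (a1 + u + ((u⁻¹ : (ZMod c)ˣ) : ZMod c)) - s (a2 + ((u⁻¹ : (ZMod c)ˣ) : ZMod c)))‖
      ≤ 2 * (∑ k : ZMod c, ‖(c : ℂ)⁻¹ * ZMod.dft f k‖) *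
        ∑ h ∈ Finset.univ.erase (0 : ZMod c), ‖(c : ℂ)⁻¹ * ZMod.dft s h‖ * B h := by
  set F := fun k => (c : ℂ)⁻¹ * ZMod.dft f k with hF
  set G := fun k => (c : ℂ)⁻¹ * ZMod.dft s k with hG
  have key : ∑ u : (ZMod c)ˣ, f u * (s (a1 + u + ((u⁻¹ : (ZMod c)ˣ) : ZMod c)) - s (a2 + ((u⁻¹ : (ZMod c)ˣ) : ZMod c)))
    = ∑ k : ZMod c, ∑ h : ZMod c, F k * G h * (ZMod.stdAddChar (h * a1) * Kl c ((h + k : ZMod c).val : ℤ) h.val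
        - ZMod.stdAddChar (h * a2) * Kl c (k.val : ℤ) h.val) := by
    have e1 : ∀ u : (ZMod c)ˣ, f u * (s (a1 + u + ((u⁻¹ : (ZMod c)ˣ) : ZMod c)) - s (a2 + ((u⁻¹ : (ZMod c)ˣ) : ZMod c)))
      = ∑ k : ZMod c, ∑ h : ZMod c, F k * G h * (ZMod.stdAddChar (h * a1) * ZMod.stdAddChar ((h + k) * (u : ZMod c) + h * ((u⁻¹ : (ZMod c)ˣ) : ZMod c))
        - ZMod.stdAddChar (h * a2) * ZMod.stdAddChar (k * (u : ZMod c) + h * ((u⁻¹ : (ZMod c)ˣ) : ZMod c))) := by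
      intro u
      rw [fourier_inv c f u, fourier_inv c s (a1 + u + _), fourier_inv c s (a2 + _), ← Finset.sum_sub_distrib,
        Finset.sum_mul_sum]
      refine Finset.sum_congr rfl fun k _ => Finset.sum_congr rfl fun h _ => ?_
      rw [← AddChar.map_add_eq_mul, ← AddChar.map_add_eq_mul, ← mul_sub, mul_mul_mul_comm, mul_sub, ← AddChar.map_add_eq_mul,
        ← AddChar.map_add_eq_mul]
      simp only [F, G]
      congr 3 <;> ring
    rw [Finset.sum_congr rfl (fun u _ => e1 u), Finset.sum_comm]
    refine Finset.sum_congr rfl fun k _ => ?_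
    rw [Finset.sum_comm]
    refine Finset.sum_congr rfl fun h _ => ?_
    rw [← Finset.mul_sum, Finset.sum_sub_distrib, ← Finset.mul_sum, ← Finset.mul_sum]
    simp [Kl]
  rw [key]
  have e2 : ∀ k h : ZMod c, ‖F k * G h * (ZMod.stdAddChar (h * a1) * Kl c ((h + k : ZMod c).val : ℤ) h.val
        - ZMod.stdAddChar (h * a2) * Kl c (k.val : ℤ) h.val)‖ ≤
      2 * ‖F k‖ * (if h = 0 then 0 else ‖G h‖ * B h) := by
    intro k h
    by_cases h0 : h = 0
    · subst h0; simp
    rw [if_neg h0, norm_mul, norm_mul]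
    have : ‖ZMod.stdAddChar (h * a1) * Kl c ((h + k : ZMod c).val : ℤ) h.val
        - ZMod.stdAddChar (h * a2) * Kl c (k.val : ℤ) h.val‖ ≤ B h + B h := by
      refine (norm_sub_le _ _).trans (add_le_add ?_ ?_)
      · rw [norm_mul, std_norm, one_mul]; exact hB _ _
      · rw [norm_mul, std_norm, one_mul]; exact hB _ _
    calc _ ≤ ‖F k‖ * ‖G h‖ * (B h + B h) := by gcongr
      _ = _ := by ring
  have e3 : ∑ h : ZMod c, (if h = 0 then 0 else ‖G h‖ * B h) = ∑ h ∈ Finset.univ.erase (0 : ZMod c), ‖G h‖ * B h := by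
    rw [← Finset.add_sum_erase _ _ (Finset.mem_univ (0 : ZMod c))]
    simp only [if_true, zero_add]
    exact Finset.sum_congr rfl fun h hh => if_neg (Finset.ne_of_mem_erase hh)
  refine (norm_sum_le _ _).trans ?_
  rw [← e3]
  change _ ≤ 2 * (∑ k, ‖F k‖) * _
  rw [Finset.mul_sum _ (fun k => ‖F k‖) 2, Finset.sum_mul]
  refine Finset.sum_le_sum fun k _ => ?_
  refine (norm_sum_le _ _).trans ?_
  rw [Finset.mul_sum]
  exact Finset.sum_le_sum fun h _ => e2 k h

theorem one_sub_lower (c : ℕ) [NeZero c] (k : ZMod c) (hk : k ≠ 0) :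
    4 * ((k.val : ℝ) / c) * (1 - k.val / c) ≤ ‖ZMod.stdAddChar (-k) - 1‖ := by
  have hc : (0 : ℝ) < c := by exact_mod_cast Nat.pos_of_ne_zero (NeZero.ne c)
  have hlt : (k.val : ℝ) < c := by exact_mod_cast ZMod.val_lt k
  have h0 : (0 : ℝ) ≤ k.val := by positivity
  set t : ℝ := k.val / c with ht
  have ht0 : 0 ≤ t := by positivity
  have ht1 : t < 1 := by rw [ht, div_lt_one hc]; exact hlt
  have e : (ZMod.stdAddChar (-k) : ℂ) = Complex.exp (Complex.I * ((-(2 * Real.pi * t) : ℝ) : ℂ)) := by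
    have : -k = ((-(k.val : ℤ) : ℤ) : ZMod c) := by simp
    rw [this, ZMod.stdAddChar_coe, ht]
    congr 1
    push_cast
    ring
  rw [e, Complex.norm_exp_I_mul_ofReal_sub_one]
  have hs : 2 * t * (1 - t) ≤ Real.sin (Real.pi * t) := by
    rcases le_total t (1/2) with h | h
    · have := Real.mul_le_sin (x := Real.pi * t) (by positivity) (by nlinarith [Real.pi_pos])
      have e : 2 / Real.pi * (Real.pi * t) = 2 * t := by field_simp
      nlinarith
    · have := Real.mul_le_sin (x := Real.pi * (1 - t)) (by have := Real.pi_pos; apply mul_nonneg this.le; linarith) (by nlinarith [Real.pi_pos])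
      have e : 2 / Real.pi * (Real.pi * (1 - t)) = 2 * (1 - t) := by field_simp
      have e2 : Real.sin (Real.pi * (1 - t)) = Real.sin (Real.pi * t) := by
        rw [mul_sub, mul_one, Real.sin_pi_sub]
      nlinarith
  have : -(2 * Real.pi * t) / 2 = -(Real.pi * t) := by ring
  rw [this, Real.sin_neg, Real.norm_eq_abs]
  have h2 := neg_le_abs (2 * -Real.sin (Real.pi * t))
  linarith

theorem coef_ind (c : ℕ) [NeZero c] (lo hi : ℕ) (hhi : hi ≤ c) (k : ZMod c) (hk : k ≠ 0) :
    ‖(c : ℂ)⁻¹ * ZMod.dft (fun j : ZMod c => if lo ≤ j.val ∧ j.val < hi then (1 : ℂ) else 0) k‖ ≤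
      (1 / 2) * (1 / k.val + 1 / (c - k.val)) := by
  have hc : (0 : ℝ) < c := by exact_mod_cast Nat.pos_of_ne_zero (NeZero.ne c)
  have hlt : (k.val : ℝ) < c := by exact_mod_cast ZMod.val_lt k
  have hpos : (0 : ℝ) < k.val := by
    have : k.val ≠ 0 := by rwa [Ne, ZMod.val_eq_zero]
    exact_mod_cast Nat.pos_of_ne_zero this
  set z : ℂ := ZMod.stdAddChar (-k) with hz
  have hzn : ‖z‖ = 1 := std_norm c _
  have hsum : ZMod.dft (fun j : ZMod c => if lo ≤ j.val ∧ j.val < hi then (1 : ℂ) else 0) k = ∑ j ∈ Finset.Ico lo hi, z ^ j := by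
    rw [ZMod.dft_apply]
    simp only [smul_eq_mul, mul_ite, mul_one, mul_zero]
    rw [← Finset.sum_filter]
    refine Finset.sum_bij (fun j _ => j.val) ?_ ?_ ?_ ?_
    · intro j hj; simpa using hj
    · intro i _ j _ h; exact ZMod.val_injective c h
    · intro j hj
      rw [Finset.mem_Ico] at hj
      have hv : ((j : ZMod c)).val = j := ZMod.val_cast_of_lt (by omega)
      refine ⟨(j : ZMod c), ?_, hv⟩
      simp [hv, hj]
    · intro j _
      rw [hz, ← AddChar.map_nsmul_eq_pow]
      congr 1
      simp
  have hle : ‖∑ j ∈ Finset.Ico lo hi, z ^ j‖ * ‖z - 1‖ ≤ 2 := by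
    rw [← norm_mul]
    by_cases h : lo ≤ hi
    · have : (∑ j ∈ Finset.Ico lo hi, z ^ j) * (z - 1) = z ^ hi - z ^ lo := by
        have h1 := Finset.sum_Ico_sub (fun j => z ^ j) h
        rw [← h1, Finset.sum_mul]
        refine Finset.sum_congr rfl fun j _ => ?_
        ring
      rw [this]
      refine (norm_sub_le _ _).trans ?_
      rw [norm_pow, norm_pow, hzn]; norm_num
    · rw [Finset.Ico_eq_empty_of_le (by omega)]; simp
  have hlow := one_sub_lower c k hk
  rw [← hz] at hlow
  rw [hsum, norm_mul, norm_inv, Complex.norm_natCast]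
  have hq : 0 < 4 * ((k.val : ℝ) / c) * (1 - k.val / c) := by
    have : (k.val : ℝ) / c < 1 := by rwa [div_lt_one hc]
    have : 0 < 1 - (k.val : ℝ) / c := by linarith
    positivity
  set S := ‖∑ j ∈ Finset.Ico lo hi, z ^ j‖
  have hS : S ≤ 2 / (4 * ((k.val : ℝ) / c) * (1 - k.val / c)) := by
    rw [le_div_iff₀ hq]
    refine le_trans ?_ hle
    gcongr
  have hck : (c : ℝ) - k.val ≠ 0 := by linarith
  calc (c : ℝ)⁻¹ * S ≤ (c : ℝ)⁻¹ * (2 / (4 * ((k.val : ℝ) / c) * (1 - k.val / c))) := by gcongr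
    _ = _ := by
      have : (1 - (k.val : ℝ) / c) = (c - k.val) / c := by field_simp
      rw [this]
      field_simp
      ring

theorem coef_saw (c : ℕ) [NeZero c] (k : ZMod c) (hk : k ≠ 0) :
    ‖(c : ℂ)⁻¹ * ZMod.dft (fun j : ZMod c => ((j.val : ℂ) / c)) k‖ ≤
      (1 / 2) * (1 / k.val + 1 / (c - k.val)) := by
  have hc : (0 : ℝ) < c := by exact_mod_cast Nat.pos_of_ne_zero (NeZero.ne c)
  have hc1 : 1 ≤ c := Nat.pos_of_ne_zero (NeZero.ne c)
  have hcC : (c : ℂ) ≠ 0 := by exact_mod_cast NeZero.ne c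
  have hs : (fun j : ZMod c => ((j.val : ℂ) / c)) = (c : ℂ)⁻¹ • ∑ a ∈ Finset.Ico 1 c,
      (fun j : ZMod c => if a ≤ j.val ∧ j.val < c then (1 : ℂ) else 0) := by
    ext j
    have hj := ZMod.val_lt j
    simp only [Pi.smul_apply, Finset.sum_apply, smul_eq_mul, hj, and_true]
    rw [← Finset.sum_filter, Finset.sum_const, nsmul_eq_mul, mul_one, div_eq_inv_mul]
    congr 2
    have : Finset.filter (fun a => a ≤ j.val) (Finset.Ico 1 c) = Finset.Ico 1 (j.val + 1) := by
      ext a; simp; omega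
    rw [this]; simp
  rw [hs, map_smul, map_sum]
  simp only [Pi.smul_apply, Finset.sum_apply, smul_eq_mul]
  rw [mul_left_comm, Finset.mul_sum, norm_mul, norm_inv, Complex.norm_natCast]
  have h1 : ‖∑ a ∈ Finset.Ico 1 c, (c : ℂ)⁻¹ * ZMod.dft (fun j : ZMod c => if a ≤ j.val ∧ j.val < c then (1 : ℂ) else 0) k‖
      ≤ ∑ a ∈ Finset.Ico 1 c, (1 / 2 : ℝ) * (1 / k.val + 1 / (c - k.val)) :=
    (norm_sum_le _ _).trans (Finset.sum_le_sum fun a _ => coef_ind c a c le_rfl k hk)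
  rw [Finset.sum_const, Nat.card_Ico, nsmul_eq_mul, Nat.cast_sub hc1] at h1
  have hlt : (k.val : ℝ) < c := by exact_mod_cast ZMod.val_lt k
  have hφ : 0 ≤ (1 / 2 : ℝ) * (1 / k.val + 1 / (c - k.val)) := by
    have : (0 : ℝ) < c - k.val := by linarith
    positivity
  rw [inv_mul_le_iff₀ hc]
  refine h1.trans ?_
  apply mul_le_mul_of_nonneg_right _ hφ
  push_cast
  linarith


theorem sum_zmod_Ico (c : ℕ) [NeZero c] (g : ℕ → ℝ) :
    ∑ k ∈ Finset.univ.erase (0 : ZMod c), g k.val = ∑ k ∈ Finset.Ico 1 c, g k := by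
  refine Finset.sum_bij (fun k _ => k.val) ?_ ?_ ?_ ?_
  · intro k hk
    have hk0 := Finset.ne_of_mem_erase hk
    have : k.val ≠ 0 := by rwa [Ne, ZMod.val_eq_zero]
    have := ZMod.val_lt k
    rw [Finset.mem_Ico]; omega
  · intro i _ j _ h; exact ZMod.val_injective c h
  · intro k hk
    rw [Finset.mem_Ico] at hk
    have hv : ((k : ZMod c)).val = k := ZMod.val_cast_of_lt (by omega)
    refine ⟨(k : ZMod c), ?_, hv⟩
    rw [Finset.mem_erase]
    refine ⟨?_, Finset.mem_univ _⟩
    intro h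
    rw [h, ZMod.val_zero] at hv
    omega
  · intro _ _; rfl

theorem sum_inv_Ico (c : ℕ) (hc : 1 ≤ c) : ∑ k ∈ Finset.Ico 1 c, (1 : ℝ) / k ≤ 1 + Real.log c := by
  have h := harmonic_le_one_add_log c
  refine le_trans ?_ h
  rw [harmonic_eq_sum_Icc]
  push_cast
  simp only [one_div]
  refine Finset.sum_le_sum_of_subset_of_nonneg ?_ (fun _ _ _ => by positivity)
  intro k hk
  rw [Finset.mem_Ico] at hk
  rw [Finset.mem_Icc]; omega

theorem sum_phi (c : ℕ) (w : ℕ → ℝ) (hw : ∀ k, k < c → w (c - k) = w k) :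
    ∑ k ∈ Finset.Ico 1 c, (1 / 2 : ℝ) * (1 / k + 1 / (c - k)) * w k = ∑ k ∈ Finset.Ico 1 c, (1 / k) * w k := by
  have h : ∑ k ∈ Finset.Ico 1 c, (1 / ((c : ℝ) - k)) * w k = ∑ k ∈ Finset.Ico 1 c, (1 / (k : ℝ)) * w k := by
    refine Finset.sum_nbij' (fun k => c - k) (fun k => c - k) ?_ ?_ ?_ ?_ ?_
    · intro k hk; rw [Finset.mem_Ico] at *; omega
    · intro k hk; rw [Finset.mem_Ico] at *; omega
    · intro k hk; rw [Finset.mem_Ico] at *; omega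
    · intro k hk; rw [Finset.mem_Ico] at *; omega
    · intro k hk; rw [Finset.mem_Ico] at *
      rw [Nat.cast_sub (by omega), hw k hk.2]
  have : ∀ k : ℕ, (1 / 2 : ℝ) * (1 / k + 1 / (c - k)) * w k = 1/2 * ((1 / k) * w k) + 1/2 * ((1 / ((c : ℝ) - k)) * w k) := by
    intro k; ring
  simp only [this]
  rw [Finset.sum_add_distrib, ← Finset.mul_sum, ← Finset.mul_sum, h]
  ring

theorem sum_gcd (c : ℕ) (hc : 1 ≤ c) :
    ∑ h ∈ Finset.Ico 1 c, (1 / h : ℝ) * (Nat.gcd h c) ≤ c.divisors.card * (1 + Real.log c) := by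
  have h1 : ∀ h ∈ Finset.Ico 1 c, (1 / h : ℝ) * (Nat.gcd h c) ≤
      ∑ g ∈ c.divisors, if g ∣ h then (g : ℝ) / h else 0 := by
    intro h hh
    have : (1 / h : ℝ) * (Nat.gcd h c) = (fun g : ℕ => if g ∣ h then (g : ℝ) / h else 0) (Nat.gcd h c) := by
      simp only [Nat.gcd_dvd_left, if_true]; ring
    rw [this]
    refine Finset.single_le_sum (f := fun g : ℕ => if g ∣ h then (g : ℝ) / h else 0) ?_ ?_
    · intro g _; split_ifs <;> positivity
    · rw [Nat.mem_divisors]; exact ⟨Nat.gcd_dvd_right _ _, by omega⟩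
  refine (Finset.sum_le_sum h1).trans ?_
  rw [Finset.sum_comm, ← nsmul_eq_mul, ← Finset.sum_const]
  refine Finset.sum_le_sum fun g hg => ?_
  have hg0 : 0 < g := Nat.pos_of_mem_divisors hg
  refine le_trans ?_ (sum_inv_Ico c hc)
  rw [← Finset.sum_filter]
  have h2 : ∑ h ∈ (Finset.Ico 1 c).filter (fun h => g ∣ h), (g : ℝ) / h =
      ∑ k ∈ ((Finset.Ico 1 c).filter (fun h => g ∣ h)).image (fun h => h / g), (1 : ℝ) / k := by
    rw [Finset.sum_image]
    · refine Finset.sum_congr rfl fun h hh => ?_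
      rw [Finset.mem_filter, Finset.mem_Ico] at hh
      obtain ⟨⟨hh1, _⟩, k, rfl⟩ := hh
      have hk : k ≠ 0 := by rintro rfl; simp at hh1
      rw [Nat.mul_div_cancel_left _ hg0]
      push_cast
      have : (g : ℝ) ≠ 0 := by exact_mod_cast hg0.ne'
      have : (k : ℝ) ≠ 0 := by exact_mod_cast hk
      field_simp
    · intro a ha b hb hab
      rw [Finset.mem_coe, Finset.mem_filter] at ha hb
      dsimp only at hab
      exact (Nat.div_left_inj ha.2 hb.2).1 hab
  rw [h2]
  refine Finset.sum_le_sum_of_subset_of_nonneg ?_ (fun _ _ _ => by positivity)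
  intro k hk
  rw [Finset.mem_image] at hk
  obtain ⟨h, hh, rfl⟩ := hk
  rw [Finset.mem_filter, Finset.mem_Ico] at hh
  rw [Finset.mem_Ico]
  refine ⟨Nat.div_pos (Nat.le_of_dvd (by omega) hh.2) hg0, lt_of_le_of_lt (Nat.div_le_self _ _) hh.1.2⟩

theorem err_bound (c : ℕ) (hc : 1 ≤ c) : ∃ s t : ℕ, 0 < s ∧ 0 < t ∧ s ^ 2 * t ^ 3 ∣ c ∧
    ∀ [NeZero c] (lo hi : ℕ) (_ : hi ≤ c) (a1 a2 : ZMod c),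
    |∑ u : (ZMod c)ˣ, if lo ≤ (u : ZMod c).val ∧ (u : ZMod c).val < hi then
      ((a1 + u + ((u⁻¹ : (ZMod c)ˣ) : ZMod c)).val : ℝ) / c - ((a2 + ((u⁻¹ : (ZMod c)ˣ) : ZMod c)).val : ℝ) / c else 0|
    ≤ 2 * (2 + Real.log c) * ((1 + Real.log c) * (c.divisors.card : ℝ) ^ 2 * Real.sqrt c * Real.sqrt (s ^ 2 * t ^ 3)) := by
  obtain ⟨s, t, hs, ht, hd, hB⟩ := Kl_bound c (by omega)
  refine ⟨s, t, hs, ht, hd, ?_⟩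
  intro _ lo hi hhi a1 a2
  set W : ℝ := (c.divisors.card : ℝ) * Real.sqrt c * Real.sqrt (s ^ 2 * t ^ 3) with hW
  have hW0 : 0 ≤ W := by positivity
  have hcR : (0 : ℝ) < c := by exact_mod_cast hc
  have hB' : ∀ (m : ℤ) (h : ZMod c), ‖Kl c m h.val‖ ≤ W * (Nat.gcd h.val c) := by
    intro m h
    have h1 := hB m h.val
    have hg : Int.gcd (h.val : ℤ) c = Nat.gcd h.val c := Int.gcd_natCast_natCast _ _
    rw [hg] at h1
    have hg1 : (1 : ℝ) ≤ (Nat.gcd h.val c : ℕ) := by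
      have : 0 < Nat.gcd h.val c := Nat.gcd_pos_of_pos_right _ (by omega)
      exact_mod_cast this
    apply le_of_sq_le_sq _ (by positivity)
    refine h1.trans ?_
    rw [mul_pow, hW, mul_pow, mul_pow, Real.sq_sqrt (by positivity), Real.sq_sqrt (by positivity)]
    have : ((Nat.gcd h.val c : ℕ) : ℝ) ≤ ((Nat.gcd h.val c : ℕ) : ℝ) ^ 2 := by nlinarith
    calc _ = (c.divisors.card : ℝ) ^ 2 * c * (s ^ 2 * t ^ 3) * (Nat.gcd h.val c : ℕ) := by ring
      _ ≤ _ := by gcongr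
  have hcomp := completion c (fun j : ZMod c => if lo ≤ j.val ∧ j.val < hi then (1 : ℂ) else 0)
    (fun j : ZMod c => ((j.val : ℂ) / c)) a1 a2 _ hB'
  have e0 : ‖∑ u : (ZMod c)ˣ, (if lo ≤ (u : ZMod c).val ∧ (u : ZMod c).val < hi then (1 : ℂ) else 0) *
      (((a1 + u + ((u⁻¹ : (ZMod c)ˣ) : ZMod c)).val : ℂ) / c - ((a2 + ((u⁻¹ : (ZMod c)ˣ) : ZMod c)).val : ℂ) / c)‖ =
     |∑ u : (ZMod c)ˣ, if lo ≤ (u : ZMod c).val ∧ (u : ZMod c).val < hi then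
      ((a1 + u + ((u⁻¹ : (ZMod c)ˣ) : ZMod c)).val : ℝ) / c - ((a2 + ((u⁻¹ : (ZMod c)ˣ) : ZMod c)).val : ℝ) / c else 0| := by
    rw [← Real.norm_eq_abs, ← Complex.norm_real]
    congr 1
    rw [Complex.ofReal_sum]
    refine Finset.sum_congr rfl fun u _ => ?_
    split_ifs
    · rw [one_mul, Complex.ofReal_sub, Complex.ofReal_div, Complex.ofReal_div, Complex.ofReal_natCast,
        Complex.ofReal_natCast, Complex.ofReal_natCast]
    · rw [zero_mul, Complex.ofReal_zero]
  rw [← e0]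
  refine hcomp.trans ?_
  have hlog : 0 ≤ Real.log c := Real.log_nonneg (by exact_mod_cast hc)
  have hF : ∑ k : ZMod c, ‖(c : ℂ)⁻¹ * ZMod.dft (fun j : ZMod c => if lo ≤ j.val ∧ j.val < hi then (1 : ℂ) else 0) k‖ ≤ 2 + Real.log c := by
    rw [← Finset.add_sum_erase _ _ (Finset.mem_univ (0 : ZMod c))]
    have z0 : ‖(c : ℂ)⁻¹ * ZMod.dft (fun j : ZMod c => if lo ≤ j.val ∧ j.val < hi then (1 : ℂ) else 0) 0‖ ≤ 1 := by
      rw [norm_mul, norm_inv, Complex.norm_natCast, inv_mul_le_iff₀ hcR, mul_one, ZMod.dft_apply_zero]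
      refine (norm_sum_le _ _).trans ?_
      calc _ ≤ ∑ j : ZMod c, (1 : ℝ) := Finset.sum_le_sum fun j _ => by split_ifs <;> simp
        _ = c := by simp [ZMod.card]
    have z1 : ∑ k ∈ Finset.univ.erase (0 : ZMod c), ‖(c : ℂ)⁻¹ * ZMod.dft (fun j : ZMod c => if lo ≤ j.val ∧ j.val < hi then (1 : ℂ) else 0) k‖
        ≤ 1 + Real.log c := by
      calc _ ≤ ∑ k ∈ Finset.univ.erase (0 : ZMod c), (1 / 2 : ℝ) * (1 / k.val + 1 / (c - k.val)) * (fun _ => (1:ℝ)) k.val :=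
            Finset.sum_le_sum fun k hk => by
              rw [mul_one]
              exact coef_ind c lo hi hhi k (Finset.ne_of_mem_erase hk)
        _ = _ := sum_zmod_Ico c (fun k => (1 / 2 : ℝ) * (1 / k + 1 / (c - k)) * (fun _ => (1:ℝ)) k)
        _ = _ := sum_phi c (fun _ => (1 : ℝ)) (fun _ _ => rfl)
        _ ≤ _ := by simpa using sum_inv_Ico c hc
    linarith
  have hG : ∑ h ∈ Finset.univ.erase (0 : ZMod c), ‖(c : ℂ)⁻¹ * ZMod.dft (fun j : ZMod c => ((j.val : ℂ) / c)) h‖ * (W * (Nat.gcd h.val c))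
      ≤ W * (c.divisors.card * (1 + Real.log c)) := by
    calc _ ≤ ∑ k ∈ Finset.univ.erase (0 : ZMod c), (1 / 2 : ℝ) * (1 / k.val + 1 / (c - k.val)) * (W * (Nat.gcd k.val c)) :=
            Finset.sum_le_sum fun k hk => by
              apply mul_le_mul_of_nonneg_right _ (by positivity)
              exact coef_saw c k (Finset.ne_of_mem_erase hk)
        _ = _ := sum_zmod_Ico c (fun k => (1 / 2 : ℝ) * (1 / k + 1 / (c - k)) * (W * (Nat.gcd k c)))
        _ = _ := sum_phi c (fun k => W * (Nat.gcd k c)) (fun k hk => by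
              rw [Nat.gcd_self_sub_left hk.le])
        _ = W * ∑ h ∈ Finset.Ico 1 c, (1 / h : ℝ) * (Nat.gcd h c) := by
              rw [Finset.mul_sum]; exact Finset.sum_congr rfl fun _ _ => by ring
        _ ≤ _ := by gcongr; exact sum_gcd c hc
  calc _ ≤ 2 * (2 + Real.log c) * (W * (c.divisors.card * (1 + Real.log c))) := by
        apply mul_le_mul _ hG (Finset.sum_nonneg fun _ _ => by positivity) (by positivity)
        gcongr
    _ = _ := by rw [hW]; ring


theorem count_one (c : ℕ) [NeZero c] (a b v : ℤ) (hab : a ≤ b) :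
    (((Finset.Ioc a b).filter (fun x => x ≡ -v [ZMOD c])).card : ℝ) =
      ((b : ℝ) - a) / c - ((((b + v : ℤ) : ZMod c).val : ℝ) / c - (((a + v : ℤ) : ZMod c).val : ℝ) / c) := by
  have hc : 0 < c := Nat.pos_of_ne_zero (NeZero.ne c)
  have hcR : (c : ℝ) ≠ 0 := by exact_mod_cast hc.ne'
  have h := Int.Ioc_filter_modEq_card a b (r := c) (by exact_mod_cast hc) (-v)
  have e : ∀ x : ℤ, ⌊((x : ℚ) - ((-v : ℤ) : ℚ)) / ((c : ℤ) : ℚ)⌋ = (x + v) / c := by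
    intro x
    have : (x : ℚ) - ((-v : ℤ) : ℚ) = ((x + v : ℤ) : ℚ) := by push_cast; ring
    rw [this]
    exact_mod_cast Rat.floor_intCast_div_natCast (x + v) c
  rw [e, e] at h
  have hm : (a + v) / (c : ℤ) ≤ (b + v) / c := Int.ediv_le_ediv (by exact_mod_cast hc) (by linarith)
  rw [max_eq_left (by linarith)] at h
  have h' : (((Finset.Ioc a b).filter (fun x => x ≡ -v [ZMOD c])).card : ℝ) =
      (((b + v) / (c : ℤ) - (a + v) / (c : ℤ) : ℤ) : ℝ) := by rw [← h]; simp
  rw [h']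
  have v1 : ∀ x : ℤ, (((x : ZMod c).val : ℝ)) = x - c * ((x / (c : ℤ) : ℤ) : ℝ) := by
    intro x
    have h1 := ZMod.val_intCast (n := c) x
    have h2 := Int.emod_add_mul_ediv x c
    have h3 : (((x : ZMod c).val : ℕ) : ℤ) = x - c * (x / c) := by rw [h1]; linarith
    exact_mod_cast congrArg (fun z : ℤ => (z : ℝ)) h3
  rw [v1, v1]
  push_cast
  field_simp
  ring

theorem sum_units_Ico (c : ℕ) [NeZero c] (lo hi : ℕ) (hhi : hi ≤ c) (g : ℕ → ℝ) :
    ∑ q ∈ (Finset.Ico lo hi).filter (fun q => q.Coprime c), g q =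
      ∑ u : (ZMod c)ˣ, if lo ≤ (u : ZMod c).val ∧ (u : ZMod c).val < hi then g (u : ZMod c).val else 0 := by
  rw [← Finset.sum_filter]
  symm
  refine Finset.sum_bij (fun u _ => (u : ZMod c).val) ?_ ?_ ?_ ?_
  · intro u hu
    rw [Finset.mem_filter] at hu
    rw [Finset.mem_filter, Finset.mem_Ico]
    exact ⟨hu.2, ZMod.val_coe_unit_coprime u⟩
  · intro u _ v _ h
    exact Units.ext (ZMod.val_injective c h)
  · intro q hq
    rw [Finset.mem_filter, Finset.mem_Ico] at hq
    have hv : ((q : ZMod c)).val = q := ZMod.val_cast_of_lt (by omega)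
    refine ⟨ZMod.unitOfCoprime q hq.2, ?_, ?_⟩
    · rw [Finset.mem_filter]
      simp [hv, hq.1]
    · simp [hv]
  · intro _ _; rfl

theorem count_c (c : ℕ) (hc : 1 ≤ c) : ∃ s t : ℕ, 0 < s ∧ 0 < t ∧ s ^ 2 * t ^ 3 ∣ c ∧
    ∀ (lo hi : ℕ) (_ : hi ≤ c) (a N : ℤ) (_ : a ≤ N + lo),
    |∑ q ∈ (Finset.Ico lo hi).filter (fun q => q.Coprime c),
      ((((Finset.Ioc a (N + q)).filter (fun x => (c : ℤ) ∣ x * q + 1)).card : ℝ) - ((N : ℝ) + q - a) / c)|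
    ≤ 2 * (2 + Real.log c) * ((1 + Real.log c) * (c.divisors.card : ℝ) ^ 2 * Real.sqrt c * Real.sqrt (s ^ 2 * t ^ 3)) := by
  obtain ⟨s, t, hs, ht, hd, hB⟩ := err_bound c hc
  refine ⟨s, t, hs, ht, hd, ?_⟩
  intro lo hi hhi a N haN
  haveI : NeZero c := ⟨by omega⟩
  have h := hB lo hi hhi ((N : ℤ) : ZMod c) ((a : ℤ) : ZMod c)
  refine le_trans (le_of_eq ?_) h
  rw [sum_units_Ico c lo hi hhi, ← abs_neg, ← Finset.sum_neg_distrib]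
  congr 1
  refine Finset.sum_congr rfl fun u _ => ?_
  split_ifs with hu
  · set q := (u : ZMod c).val with hq
    set v : ℤ := (((u⁻¹ : (ZMod c)ˣ) : ZMod c).val : ℤ) with hv
    have hvc : ((v : ℤ) : ZMod c) = ((u⁻¹ : (ZMod c)ˣ) : ZMod c) := by simp [hv]
    have hqc : ((q : ℕ) : ZMod c) = (u : ZMod c) := by simp [hq]
    have hfil : (Finset.Ioc a (N + q)).filter (fun x => (c : ℤ) ∣ x * q + 1) =
        (Finset.Ioc a (N + q)).filter (fun x => x ≡ -v [ZMOD c]) := by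
      refine Finset.filter_congr fun x _ => ?_
      rw [← ZMod.intCast_zmod_eq_zero_iff_dvd, ← ZMod.intCast_eq_intCast_iff]
      push_cast
      rw [hvc, hqc]
      constructor
      · intro h
        have : (x : ZMod c) = (x * u + 1) * ((u⁻¹ : (ZMod c)ˣ) : ZMod c) - ((u⁻¹ : (ZMod c)ˣ) : ZMod c) := by
          rw [add_mul, mul_assoc, Units.mul_inv]; ring
        rw [this, h]; ring
      · intro h
        rw [h, neg_mul, Units.inv_mul]; ring
    rw [hfil, count_one c a (N + q) v (by have := hu.1; have : (lo : ℤ) ≤ q := by exact_mod_cast this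
                                          linarith)]
    push_cast
    rw [hvc, hqc]
    ring
  · simp


theorem divisor_bound (δ : ℝ) (hδ : 0 < δ) : ∃ C > (0 : ℝ), ∀ n : ℕ, n ≠ 0 → (n.divisors.card : ℝ) ≤ C * (n : ℝ) ^ δ := by
  set K : ℝ := 1 + 1 / (δ * Real.log 2) with hK
  have hl2 : 0 < Real.log 2 := Real.log_pos (by norm_num)
  have hK1 : 1 ≤ K := by rw [hK]; have : 0 ≤ 1 / (δ * Real.log 2) := by positivity
                         linarith
  obtain ⟨P, hP⟩ := exists_nat_gt ((2 : ℝ) ^ (1 / δ))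
  have key : ∀ n : ℕ, n ≠ 0 → (n.divisors.card : ℝ) ≤ (∏ p ∈ n.primeFactors, if p < P then K else 1) * (n : ℝ) ^ δ := by
    intro n
    induction n using Nat.recOnPosPrimePosCoprime with
    | zero => intro h; exact absurd rfl h
    | one => intro _; simp
    | prime_pow p k hp hk =>
      intro _
      rw [Nat.divisors_prime_pow hp, Finset.card_map, Finset.card_range, Nat.primeFactors_prime_pow hk.ne' hp,
        Finset.prod_singleton]
      have hp0 : (0 : ℝ) ≤ p := by positivity
      have hpk : (((p ^ k : ℕ) : ℝ)) ^ δ = ((p : ℝ) ^ δ) ^ k := by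
        push_cast
        rw [← Real.rpow_natCast, ← Real.rpow_natCast, ← Real.rpow_mul hp0, ← Real.rpow_mul hp0, mul_comm]
      rw [hpk]
      split_ifs with h
      · have h1 : (2 : ℝ) ^ δ ≤ (p : ℝ) ^ δ := by
          apply Real.rpow_le_rpow (by norm_num) _ hδ.le
          exact_mod_cast hp.two_le
        have h2 : 1 + δ * Real.log 2 ≤ (2 : ℝ) ^ δ := by
          rw [Real.rpow_def_of_pos (by norm_num)]
          have := Real.add_one_le_exp (Real.log 2 * δ)
          linarith
        have h3 : 1 + (k : ℝ) * (δ * Real.log 2) ≤ (1 + δ * Real.log 2) ^ k := by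
          apply one_add_mul_le_pow
          have : 0 < δ * Real.log 2 := by positivity
          linarith
        have h4 : (1 + δ * Real.log 2) ^ k ≤ ((p : ℝ) ^ δ) ^ k := by
          apply pow_le_pow_left₀ (by positivity)
          linarith
        have h5 : (k : ℝ) + 1 ≤ K * (1 + (k : ℝ) * (δ * Real.log 2)) := by
          have e : K * (1 + (k : ℝ) * (δ * Real.log 2)) = 1 + k + (1 / (δ * Real.log 2) + k * (δ * Real.log 2)) := by
            rw [hK]; field_simp; ring
          rw [e]
          have : 0 ≤ 1 / (δ * Real.log 2) + k * (δ * Real.log 2) := by positivity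
          linarith
        push_cast
        refine h5.trans ?_
        gcongr
        linarith
      · have h1 : (2 : ℝ) ≤ (p : ℝ) ^ δ := by
          have h6 : (2 : ℝ) ^ (1 / δ) ≤ p := hP.le.trans (by exact_mod_cast not_lt.1 h)
          calc (2 : ℝ) = ((2 : ℝ) ^ (1 / δ)) ^ δ := by
                rw [← Real.rpow_mul (by norm_num), one_div_mul_cancel hδ.ne', Real.rpow_one]
            _ ≤ _ := Real.rpow_le_rpow (by positivity) h6 hδ.le
        rw [one_mul]
        have h2 : ((k + 1 : ℕ) : ℝ) ≤ 2 ^ k := by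
          have : k + 1 ≤ 2 ^ k := Nat.lt_two_pow_self
          exact_mod_cast this
        refine h2.trans ?_
        gcongr
    | coprime a b ha hb hab iha ihb =>
      intro _
      have h1 := iha (by omega)
      have h2 := ihb (by omega)
      rw [Nat.Coprime.card_divisors_mul hab, Nat.primeFactors_mul (by omega) (by omega),
        Finset.prod_union hab.disjoint_primeFactors]
      push_cast
      rw [Real.mul_rpow (by positivity) (by positivity)]
      have hnn : ∀ s : Finset ℕ, 0 ≤ ∏ p ∈ s, (if p < P then K else 1) := fun s =>
        Finset.prod_nonneg fun p _ => by split_ifs <;> linarith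
      calc _ ≤ _ := mul_le_mul h1 h2 (by positivity) (mul_nonneg (hnn _) (by positivity))
        _ = _ := by ring
  refine ⟨K ^ P, by positivity, fun n hn => (key n hn).trans ?_⟩
  gcongr
  rw [Finset.prod_ite, Finset.prod_const_one, mul_one, Finset.prod_const]
  apply pow_le_pow_right₀ hK1
  calc _ ≤ (Finset.range P).card := by
        apply Finset.card_le_card
        intro p hp
        rw [Finset.mem_filter] at hp
        exact Finset.mem_range.2 hp.2
    _ = P := Finset.card_range P

theorem sum_inv_Icc (X : ℕ) : ∑ k ∈ Finset.Icc 1 X, (1 : ℝ) / k ≤ 1 + Real.log X := by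
  have h := harmonic_le_one_add_log X
  rw [harmonic_eq_sum_Icc] at h
  push_cast at h
  simpa only [one_div] using h

theorem powerful_sum (X : ℕ) (S T : ℕ → ℕ)
    (hST : ∀ c, 1 ≤ c → 0 < S c ∧ 0 < T c ∧ S c ^ 2 * T c ^ 3 ∣ c) :
    ∑ c ∈ Finset.Icc 1 X, Real.sqrt ((S c : ℝ) ^ 2 * (T c : ℝ) ^ 3) ≤ X * (1 + Real.log X) ^ 2 := by
  set I := Finset.Icc 1 X with hI
  have h1 : ∀ c ∈ I, Real.sqrt ((S c : ℝ) ^ 2 * (T c : ℝ) ^ 3) ≤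
      ∑ z ∈ I ×ˢ I, if z.1 ^ 2 * z.2 ^ 3 ∣ c then Real.sqrt ((z.1 : ℝ) ^ 2 * (z.2 : ℝ) ^ 3) else 0 := by
    intro c hc
    rw [hI, Finset.mem_Icc] at hc
    obtain ⟨hs, ht, hd⟩ := hST c hc.1
    have := Finset.single_le_sum (f := fun z : ℕ × ℕ => if z.1 ^ 2 * z.2 ^ 3 ∣ c then Real.sqrt ((z.1 : ℝ) ^ 2 * (z.2 : ℝ) ^ 3) else 0)
      (s := I ×ˢ I) (a := (S c, T c)) (fun z _ => by split_ifs <;> positivity) (by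
        have hle := Nat.le_of_dvd (by omega) hd
        have a1 : S c ≤ S c ^ 2 * T c ^ 3 := by
          calc S c ≤ S c ^ 2 := Nat.le_self_pow (by norm_num) _
            _ ≤ _ := Nat.le_mul_of_pos_right _ (by positivity)
        have a2 : T c ≤ S c ^ 2 * T c ^ 3 := by
          calc T c ≤ T c ^ 3 := Nat.le_self_pow (by norm_num) _
            _ ≤ _ := Nat.le_mul_of_pos_left _ (by positivity)
        rw [Finset.mem_product, hI, Finset.mem_Icc, Finset.mem_Icc]
        dsimp only
        omega)
    simpa only [hd, if_true] using this
  refine (Finset.sum_le_sum h1).trans ?_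
  rw [Finset.sum_comm]
  have h2 : ∀ z ∈ I ×ˢ I, (∑ c ∈ I, if z.1 ^ 2 * z.2 ^ 3 ∣ c then Real.sqrt ((z.1 : ℝ) ^ 2 * (z.2 : ℝ) ^ 3) else 0) ≤
      X * ((1 / (z.1 : ℝ)) * (1 / (z.2 : ℝ))) := by
    rintro ⟨s, t⟩ hz
    rw [Finset.mem_product, hI, Finset.mem_Icc, Finset.mem_Icc] at hz
    dsimp only at hz ⊢
    have hs : (1 : ℝ) ≤ s := by exact_mod_cast hz.1.1
    have ht : (1 : ℝ) ≤ t := by exact_mod_cast hz.2.1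
    rw [← Finset.sum_filter, Finset.sum_const, nsmul_eq_mul]
    have hcard : ((I.filter (fun c => s ^ 2 * t ^ 3 ∣ c)).card : ℝ) ≤ X / (s ^ 2 * t ^ 3) := by
      have e : I.filter (fun c => s ^ 2 * t ^ 3 ∣ c) = (Finset.Ioc 0 X).filter (fun c => s ^ 2 * t ^ 3 ∣ c) := by
        ext c; simp [hI]; omega
      rw [e, Nat.Ioc_filter_dvd_card_eq_div]
      refine Nat.cast_div_le.trans (le_of_eq ?_)
      push_cast; rfl
    have hsq : Real.sqrt ((s : ℝ) ^ 2 * (t : ℝ) ^ 3) ≤ s * t ^ 2 := by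
      rw [show ((s : ℝ) * t ^ 2) = Real.sqrt ((s * t ^ 2) ^ 2) by rw [Real.sqrt_sq (by positivity)]]
      apply Real.sqrt_le_sqrt
      rw [mul_pow, ← pow_mul]
      gcongr
      norm_num
    calc _ ≤ (X / (s ^ 2 * t ^ 3) : ℝ) * (s * t ^ 2) := by gcongr
      _ = _ := by field_simp
  refine (Finset.sum_le_sum h2).trans ?_
  rw [← Finset.mul_sum]
  gcongr
  rw [Finset.sum_product, sq]
  simp only
  rw [← Finset.sum_mul_sum]
  have h3 := sum_inv_Icc X
  have h4 : 0 ≤ ∑ k ∈ Finset.Icc 1 X, (1 : ℝ) / k := Finset.sum_nonneg fun _ _ => by positivity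
  gcongr

theorem log_bd (δ : ℝ) (hδ : 0 < δ) (x : ℝ) (hx : 1 ≤ x) : 1 + Real.log x ≤ (1 + 1 / δ) * x ^ δ := by
  have h1 := Real.log_le_rpow_div (x := x) (by linarith) hδ
  have h2 : 1 ≤ x ^ δ := Real.one_le_rpow hx hδ.le
  have : (1 + 1 / δ) * x ^ δ = x ^ δ + x ^ δ / δ := by ring
  linarith

theorem err_sum (ε : ℝ) (hε : 0 < ε) : ∃ C > (0 : ℝ), ∀ X : ℕ, 1 ≤ X → ∀ S T : ℕ → ℕ,
    (∀ c, 1 ≤ c → 0 < S c ∧ 0 < T c ∧ S c ^ 2 * T c ^ 3 ∣ c) →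
    ∑ c ∈ Finset.Icc 1 X, 2 * (2 + Real.log c) * ((1 + Real.log c) * (c.divisors.card : ℝ) ^ 2 *
      Real.sqrt c * Real.sqrt ((S c : ℝ) ^ 2 * (T c : ℝ) ^ 3)) ≤ C * (X : ℝ) ^ ((3 : ℝ) / 2 + ε) := by
  set δ := ε / 6 with hδ
  have hδ0 : 0 < δ := by positivity
  obtain ⟨D, hD, hdiv⟩ := divisor_bound δ hδ0
  set L := 1 + 1 / δ with hL
  have hL0 : 0 < L := by positivity
  refine ⟨2 * (2 * L) * (L * D ^ 2) * L ^ 2, by positivity, ?_⟩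
  intro X hX S T hST
  have hXR : (1 : ℝ) ≤ X := by exact_mod_cast hX
  set Y := (X : ℝ) ^ δ with hY
  have hY1 : 1 ≤ Y := Real.one_le_rpow hXR hδ0.le
  have hterm : ∀ c ∈ Finset.Icc 1 X, 2 * (2 + Real.log c) * ((1 + Real.log c) * (c.divisors.card : ℝ) ^ 2 *
      Real.sqrt c * Real.sqrt ((S c : ℝ) ^ 2 * (T c : ℝ) ^ 3)) ≤
      2 * (2 * (L * Y)) * ((L * Y) * (D * Y) ^ 2 * Real.sqrt X) * Real.sqrt ((S c : ℝ) ^ 2 * (T c : ℝ) ^ 3) := by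
    intro c hc
    rw [Finset.mem_Icc] at hc
    have hc1 : (1 : ℝ) ≤ c := by exact_mod_cast hc.1
    have hcX : (c : ℝ) ≤ X := by exact_mod_cast hc.2
    have hcY : (c : ℝ) ^ δ ≤ Y := Real.rpow_le_rpow (by linarith) hcX hδ0.le
    have hl0 : 0 ≤ Real.log c := Real.log_nonneg hc1
    have l1 : 1 + Real.log c ≤ L * Y := (log_bd δ hδ0 c hc1).trans (by gcongr)
    have l2 : 2 + Real.log c ≤ 2 * (L * Y) := by linarith
    have l3 : (c.divisors.card : ℝ) ≤ D * Y := (hdiv c (by omega)).trans (by gcongr)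
    rw [mul_assoc (2 * (2 * (L * Y)))]
    gcongr
  refine (Finset.sum_le_sum hterm).trans ?_
  rw [← Finset.mul_sum]
  have hp := powerful_sum X S T hST
  have l1 : 1 + Real.log X ≤ L * Y := log_bd δ hδ0 X hXR
  have hl0 : 0 ≤ Real.log X := Real.log_nonneg hXR
  have hp2 : ∑ c ∈ Finset.Icc 1 X, Real.sqrt ((S c : ℝ) ^ 2 * (T c : ℝ) ^ 3) ≤ X * (L * Y) ^ 2 := by
    refine hp.trans ?_
    gcongr
  have hpow : (X : ℝ) ^ ((3 : ℝ) / 2 + ε) = Y ^ 6 * (Real.sqrt X * X) := by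
    have hX0 : (0 : ℝ) < X := by linarith
    have e1 : Y ^ 6 = (X : ℝ) ^ ε := by
      rw [hY, ← Real.rpow_natCast, ← Real.rpow_mul hX0.le]
      congr 1
      rw [hδ]; push_cast; ring
    have e2 : Real.sqrt X * X = (X : ℝ) ^ ((3 : ℝ) / 2) := by
      rw [Real.sqrt_eq_rpow, ← Real.rpow_add_one hX0.ne']
      norm_num
    rw [e1, e2, ← Real.rpow_add hX0, add_comm]
  rw [hpow]
  calc _ ≤ 2 * (2 * (L * Y)) * ((L * Y) * (D * Y) ^ 2 * Real.sqrt X) * (X * (L * Y) ^ 2) := by gcongr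
    _ = _ := by ring


theorem U_closed (Y γ : ℝ) (n : ℕ) : ∑ c ∈ Finset.Icc 1 n, (Y - γ * c) ^ 2 / c =
    Y ^ 2 * (∑ c ∈ Finset.Icc 1 n, (1 : ℝ) / c) - 2 * γ * Y * n + γ ^ 2 * (n * (n + 1) / 2) := by
  induction n with
  | zero => simp
  | succ n ih =>
    rw [Finset.sum_Icc_succ_top (by omega), Finset.sum_Icc_succ_top (by omega), ih]
    push_cast
    have : (n : ℝ) + 1 ≠ 0 := by positivity
    field_simp
    ring

theorem harm_bd (n : ℕ) (hn : 1 ≤ n) (x : ℝ) (h1 : (n : ℝ) ≤ x) (h2 : x < n + 1) :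
    |(∑ c ∈ Finset.Icc 1 n, (1 : ℝ) / c) - Real.log x - Real.eulerMascheroniConstant| ≤ 2 / x := by
  have hn1 : (1 : ℝ) ≤ n := by exact_mod_cast hn
  have hH : (∑ c ∈ Finset.Icc 1 n, (1 : ℝ) / c) = (harmonic n : ℝ) := by
    rw [harmonic_eq_sum_Icc]; push_cast; simp only [one_div]
  have a1 := Real.eulerMascheroniSeq_lt_eulerMascheroniConstant n
  have a2 := Real.eulerMascheroniConstant_lt_eulerMascheroniSeq' n
  rw [Real.eulerMascheroniSeq] at a1
  rw [Real.eulerMascheroniSeq', if_neg (by omega)] at a2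
  have b1 : Real.log n ≤ Real.log x := Real.log_le_log (by linarith) h1
  have b2 : Real.log x ≤ Real.log (n + 1) := Real.log_le_log (by linarith) h2.le
  have b3 : Real.log (n + 1) - Real.log n ≤ 2 / x := by
    rw [← Real.log_div (by positivity) (by positivity)]
    refine (Real.log_le_sub_one_of_pos (by positivity)).trans ?_
    have : ((n : ℝ) + 1) / n - 1 = 1 / n := by field_simp; ring
    rw [this, div_le_div_iff₀ (by linarith) (by linarith)]
    linarith
  rw [hH, abs_le]
  constructor <;> linarith

theorem U_asymp (γ : ℝ) (hγ : 0 < γ) (Y : ℝ) (hY : 0 < Y) (Z : ℕ) (hZ : Y < γ * (Z + 1)) :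
    |∑ c ∈ Finset.Icc 1 Z, (max 0 (Y - γ * c)) ^ 2 / c -
      Y ^ 2 * (Real.log (Y / γ) + Real.eulerMascheroniConstant - 3 / 2)| ≤ 4 * γ * Y := by
  set x := Y / γ with hx
  have hYx : Y = γ * x := by rw [hx]; field_simp
  have hx0 : 0 < x := by positivity
  set n := ⌊x⌋₊ with hn
  have hn1 : (n : ℝ) ≤ x := Nat.floor_le hx0.le
  have hn2 : x < n + 1 := Nat.lt_floor_add_one x
  have hnZ : n ≤ Z := by
    have : x < (Z + 1 : ℕ) := by
      rw [hx, div_lt_iff₀ hγ]; push_cast; linarith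
    have := (Nat.floor_lt hx0.le).2 this
    omega
  have hsum : ∑ c ∈ Finset.Icc 1 Z, (max 0 (Y - γ * c)) ^ 2 / c = ∑ c ∈ Finset.Icc 1 n, (Y - γ * c) ^ 2 / c := by
    symm
    have : ∑ c ∈ Finset.Icc 1 n, (Y - γ * c) ^ 2 / c = ∑ c ∈ Finset.Icc 1 n, (max 0 (Y - γ * c)) ^ 2 / c := by
      refine Finset.sum_congr rfl fun c hc => ?_
      rw [Finset.mem_Icc] at hc
      have : (c : ℝ) ≤ n := by exact_mod_cast hc.2
      rw [max_eq_right]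
      rw [hYx]; nlinarith
    rw [this]
    apply Finset.sum_subset (Finset.Icc_subset_Icc_right hnZ)
    intro c hc hc'
    rw [Finset.mem_Icc] at hc hc'
    have : (n : ℝ) + 1 ≤ c := by
      have : n + 1 ≤ c := by omega
      exact_mod_cast this
    rw [max_eq_left]
    · simp
    · rw [hYx]; nlinarith
  rw [hsum]
  have hE1 := Real.one_half_lt_eulerMascheroniConstant
  have hE2 := Real.eulerMascheroniConstant_lt_two_thirds
  by_cases h0 : n = 0
  · rw [h0]
    simp only [Finset.Icc_eq_empty_of_lt (Nat.zero_lt_one), Finset.sum_empty, zero_sub, abs_neg]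
    rw [h0] at hn2
    simp only [Nat.cast_zero, zero_add] at hn2
    have hl1 : Real.log x < 0 := Real.log_neg hx0 hn2
    have hl2 : -Real.log x ≤ 1 / x := by
      rw [← Real.log_inv]
      have := Real.log_le_sub_one_of_pos (x := x⁻¹) (by positivity)
      rw [one_div]; linarith
    have hl3 : -(x * Real.log x) ≤ 1 := by
      have := mul_le_mul_of_nonneg_left hl2 hx0.le
      rw [mul_one_div_cancel hx0.ne'] at this
      linarith
    have : |x * (Real.log x + Real.eulerMascheroniConstant - 3 / 2)| ≤ 4 := by
      rw [abs_le]; constructor <;> nlinarith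
    have e : Y ^ 2 * (Real.log x + Real.eulerMascheroniConstant - 3 / 2) =
        γ * Y * (x * (Real.log x + Real.eulerMascheroniConstant - 3 / 2)) := by
      rw [hYx]; ring
    rw [e, abs_mul, abs_of_pos (by positivity)]
    nlinarith [mul_pos hγ hY]
  · have hn1' : 1 ≤ n := by omega
    have hb := harm_bd n hn1' x hn1 hn2
    have hnR : (1 : ℝ) ≤ n := by exact_mod_cast hn1'
    rw [U_closed]
    set H := ∑ c ∈ Finset.Icc 1 n, (1 : ℝ) / c
    have e : Y ^ 2 * H - 2 * γ * Y * n + γ ^ 2 * (n * (n + 1) / 2) - Y ^ 2 * (Real.log x + Real.eulerMascheroniConstant - 3 / 2)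
      = Y ^ 2 * (H - Real.log x - Real.eulerMascheroniConstant) + γ ^ 2 * (3 / 2 * x ^ 2 - 2 * x * n + n * (n + 1) / 2) := by
      rw [hYx]; ring
    rw [e]
    have e1 : |Y ^ 2 * (H - Real.log x - Real.eulerMascheroniConstant)| ≤ 2 * γ * Y := by
      rw [abs_mul, abs_of_pos (by positivity)]
      calc _ ≤ Y ^ 2 * (2 / x) := by gcongr
        _ = _ := by rw [hYx]; field_simp
    have e2 : |γ ^ 2 * (3 / 2 * x ^ 2 - 2 * x * n + n * (n + 1) / 2)| ≤ 2 * γ * Y := by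
      rw [abs_mul, abs_of_pos (by positivity), hYx]
      have : |3 / 2 * x ^ 2 - 2 * x * n + n * (n + 1) / 2| ≤ 2 * x := by
        rw [abs_le]; constructor <;> nlinarith
      calc _ ≤ γ ^ 2 * (2 * x) := by gcongr
        _ = _ := by ring
    refine (abs_add_le _ _).trans ?_
    linarith


theorem G_step (x : ℝ) : max 0 x ≤ (max 0 (x + 1)) ^ 2 / 2 - (max 0 x) ^ 2 / 2 ∧
    (max 0 (x + 1)) ^ 2 / 2 - (max 0 x) ^ 2 / 2 ≤ max 0 (x + 1) := by
  rcases le_total 0 x with h | h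
  · rw [max_eq_right h, max_eq_right (by linarith)]
    constructor <;> nlinarith
  · rw [max_eq_left h]
    rcases le_total 0 (x + 1) with h' | h'
    · rw [max_eq_right h']
      constructor <;> nlinarith
    · rw [max_eq_left h']
      constructor <;> norm_num

theorem inner_G (y : ℝ) (n : ℕ) :
    (max 0 (y + n)) ^ 2 / 2 - (max 0 y) ^ 2 / 2 ≤ ∑ q ∈ Finset.range (n + 1), max 0 (y + q) ∧
    ∑ q ∈ Finset.range (n + 1), max 0 (y + q) ≤
      (max 0 (y + n)) ^ 2 / 2 - (max 0 y) ^ 2 / 2 + max 0 (y + n) := by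
  induction n with
  | zero => simp
  | succ n ih =>
    rw [Finset.sum_range_succ]
    have := G_step (y + n)
    push_cast
    rw [← add_assoc]
    constructor <;> linarith [ih.1, ih.2, this.1, this.2]

theorem inner_G' (y w : ℝ) (hw : 0 ≤ w) :
    |∑ q ∈ Finset.range (⌊w⌋₊ + 1), max 0 (y + q) -
      ((max 0 (y + w)) ^ 2 / 2 - (max 0 y) ^ 2 / 2)| ≤ max 0 (y + w) := by
  have h1 := Nat.floor_le hw
  have h2 := Nat.lt_floor_add_one w
  obtain ⟨a1, a2⟩ := inner_G y ⌊w⌋₊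
  set n : ℝ := (⌊w⌋₊ : ℝ)
  have m1 : max 0 (y + n) ≤ max 0 (y + w) := max_le_max le_rfl (by linarith)
  have m0 : 0 ≤ max 0 (y + n) := le_max_left _ _
  have m2 : max 0 (y + w) ≤ max 0 (y + n) + 1 := by
    apply max_le (by linarith)
    linarith [le_max_right 0 (y + n)]
  have m3 : (max 0 (y + w)) ^ 2 / 2 - (max 0 (y + n)) ^ 2 / 2 ≤ max 0 (y + w) := by nlinarith
  rw [abs_le]
  constructor <;> nlinarith

theorem filter_floor (α : ℝ) (hα : 1 ≤ α) (c : ℕ) :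
    (Finset.range (c + 1)).filter (fun q : ℕ => α * q ≤ c) = Finset.range (⌊(c : ℝ) / α⌋₊ + 1) := by
  ext q
  have h0 : 0 < α := by linarith
  rw [Finset.mem_filter, Finset.mem_range, Finset.mem_range, Nat.lt_succ_iff, Nat.lt_succ_iff,
    Nat.le_floor_iff (by positivity), le_div_iff₀ h0, mul_comm]
  constructor
  · exact fun h => h.2
  · intro h
    refine ⟨?_, h⟩
    have : (q : ℝ) ≤ c := by nlinarith [Nat.cast_nonneg (α := ℝ) q]
    exact_mod_cast this

theorem sum_pos_part (γ : ℝ) (hγ : 0 < γ) : ∃ C > 0, ∀ Y : ℝ, 0 < Y → ∀ Z : ℕ,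
    ∑ c ∈ Finset.Icc 1 Z, max 0 (Y - γ * c) / c ≤ C * Y ^ ((3 : ℝ) / 2) := by
  have hs : Summable (fun n : ℕ => 1 / (n : ℝ) ^ ((3 : ℝ) / 2)) :=
    Real.summable_one_div_nat_rpow.2 (by norm_num)
  have hK : 0 ≤ ∑' n : ℕ, 1 / (n : ℝ) ^ ((3 : ℝ) / 2) := tsum_nonneg fun n => by positivity
  refine ⟨γ ^ (-(1 : ℝ) / 2) * (∑' n : ℕ, 1 / (n : ℝ) ^ ((3 : ℝ) / 2) + 1), by positivity, ?_⟩
  intro Y hY Z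
  have key : ∀ c ∈ Finset.Icc 1 Z, max 0 (Y - γ * c) / c ≤
      γ ^ (-(1 : ℝ) / 2) * Y ^ ((3 : ℝ) / 2) * (1 / (c : ℝ) ^ ((3 : ℝ) / 2)) := by
    intro c hc
    rw [Finset.mem_Icc] at hc
    have hc0 : (0 : ℝ) < c := by exact_mod_cast hc.1
    rcases le_total (Y - γ * c) 0 with h | h
    · rw [max_eq_left h]; simp only [zero_div]; positivity
    · rw [max_eq_right h]
      have e : γ ^ (-(1 : ℝ) / 2) * Y ^ ((3 : ℝ) / 2) * (1 / (c : ℝ) ^ ((3 : ℝ) / 2)) =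
          Y * (Y / (γ * c)) ^ ((1 : ℝ) / 2) / c := by
        rw [Real.div_rpow hY.le (by positivity), Real.mul_rpow hγ.le hc0.le,
          show (3 : ℝ) / 2 = 1 + 1 / 2 by norm_num, Real.rpow_add hY, Real.rpow_add hc0,
          show -(1 : ℝ) / 2 = -(1 / 2) by norm_num, Real.rpow_neg hγ.le, Real.rpow_one, Real.rpow_one]
        have : γ ^ ((1 : ℝ) / 2) ≠ 0 := by positivity
        have : (c : ℝ) ^ ((1 : ℝ) / 2) ≠ 0 := by positivity
        field_simp
      rw [e]
      have : 1 ≤ (Y / (γ * c)) ^ ((1 : ℝ) / 2) := by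
        apply Real.one_le_rpow _ (by norm_num)
        rw [le_div_iff₀ (by positivity)]; linarith
      gcongr
      have : 0 < γ * c := by positivity
      nlinarith
  refine (Finset.sum_le_sum key).trans ?_
  rw [← Finset.mul_sum]
  have := hs.sum_le_tsum (Finset.Icc 1 Z) (fun i _ => by positivity)
  calc _ ≤ γ ^ (-(1 : ℝ) / 2) * Y ^ ((3 : ℝ) / 2) * (∑' n : ℕ, 1 / (n : ℝ) ^ ((3 : ℝ) / 2) + 1) := by
        gcongr; linarith
    _ = _ := by ring

theorem T_asymp (α β : ℝ) (hα : 1 ≤ α) (hβ : 1 ≤ β) (hαβ : 1 < α * β) : ∃ C > 0,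
    ∀ Y : ℝ, 0 < Y → ∀ Z : ℕ, Y < (β - 1 / α) * (Z + 1) →
    |∑ c ∈ Finset.Icc 1 Z, ∑ q ∈ (Finset.range (c + 1)).filter (fun q : ℕ => α * q ≤ c),
        max 0 (Y + q - β * c) / c - Y ^ 2 * Real.log (α * β / (α * β - 1)) / 2|
      ≤ C * (Y + Y ^ ((3 : ℝ) / 2)) := by
  have hα0 : 0 < α := by linarith
  set γ := β - 1 / α with hγd
  have hγ : 0 < γ := by
    have : 1 / α < β := by rw [div_lt_iff₀ hα0]; linarith
    linarith
  have hγβ : γ ≤ β := by have : 0 < 1 / α := by positivity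
                         linarith
  obtain ⟨C, hC, hsum⟩ := sum_pos_part γ hγ
  have hβ0 : 0 < β := by linarith
  refine ⟨C + 2 * γ + 2 * β, by positivity, ?_⟩
  intro Y hY Z hZ
  have u1 := U_asymp γ hγ Y hY Z hZ
  have u2 := U_asymp β (by linarith) Y hY Z (hZ.trans_le (by gcongr))
  have hs := hsum Y hY Z
  have hL : Real.log (α * β / (α * β - 1)) = Real.log (Y / γ) - Real.log (Y / β) := by
    rw [Real.log_div hY.ne' hγ.ne', Real.log_div hY.ne' hβ0.ne']
    have : α * β / (α * β - 1) = β / γ := by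
      have h1 : α * β - 1 ≠ 0 := by linarith
      have : γ = (α * β - 1) / α := by rw [hγd]; field_simp
      rw [this]; field_simp
    rw [this, Real.log_div hβ0.ne' hγ.ne']; ring
  have key : |∑ c ∈ Finset.Icc 1 Z, ∑ q ∈ (Finset.range (c + 1)).filter (fun q : ℕ => α * q ≤ c),
        max 0 (Y + q - β * c) / c - (∑ c ∈ Finset.Icc 1 Z, (max 0 (Y - γ * c)) ^ 2 / c - 
        ∑ c ∈ Finset.Icc 1 Z, (max 0 (Y - β * c)) ^ 2 / c) / 2| ≤ 
        ∑ c ∈ Finset.Icc 1 Z, max 0 (Y - γ * c) / c := by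
    rw [← Finset.sum_sub_distrib, Finset.sum_div, ← Finset.sum_sub_distrib]
    refine (Finset.abs_sum_le_sum_abs _ _).trans (Finset.sum_le_sum fun c hc => ?_)
    rw [Finset.mem_Icc] at hc
    have hc0 : (0 : ℝ) < c := by exact_mod_cast hc.1
    have := inner_G' (Y - β * c) (c / α) (by positivity)
    rw [filter_floor α hα, ← Finset.sum_div, le_div_iff₀ hc0, ← abs_of_pos hc0, ← abs_mul, abs_of_pos hc0]
    have e : Y - β * c + c / α = Y - γ * c := by rw [hγd]; field_simp; ring
    rw [e] at this
    have e2 : ∑ q ∈ Finset.range (⌊(c : ℝ) / α⌋₊ + 1), max 0 (Y + (q : ℝ) - β * c) =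
        ∑ q ∈ Finset.range (⌊(c : ℝ) / α⌋₊ + 1), max 0 (Y - β * c + (q : ℝ)) :=
      Finset.sum_congr rfl fun q _ => by rw [show Y + (q : ℝ) - β * c = Y - β * c + q by ring]
    rw [e2]
    refine le_trans (le_of_eq ?_) this
    congr 1
    field_simp
  rw [hL]
  rw [abs_le] at *
  have hY3 : 0 < Y ^ ((3 : ℝ) / 2) := by positivity
  have : 0 < C * Y := by positivity
  have : 0 < γ * Y ^ ((3 : ℝ) / 2) := by positivity
  have : 0 < β * Y ^ ((3 : ℝ) / 2) := by positivity
  constructor <;> nlinarith [u1.1, u1.2, u2.1, u2.2, key.1, key.2]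


theorem sum_dvd_Icc (X d : ℕ) (hd : 0 < d) (g : ℕ → ℝ) :
    ∑ c ∈ Finset.Icc 1 X, (if d ∣ c then g c else 0) = ∑ c ∈ Finset.Icc 1 (X / d), g (d * c) := by
  rw [← Finset.sum_filter]
  symm
  refine Finset.sum_nbij' (fun c => d * c) (fun c => c / d) ?_ ?_ ?_ ?_ ?_
  · intro c hc
    simp only [Finset.mem_Icc, Finset.mem_filter] at hc ⊢
    refine ⟨⟨Nat.mul_pos hd hc.1, ?_⟩, dvd_mul_right _ _⟩
    have := (Nat.le_div_iff_mul_le hd).1 hc.2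
    linarith [mul_comm c d]
  · intro c hc
    simp only [Finset.mem_Icc, Finset.mem_filter] at hc ⊢
    exact ⟨Nat.div_pos (Nat.le_of_dvd hc.1.1 hc.2) hd, Nat.div_le_div_right hc.1.2⟩
  · intro c _
    exact Nat.mul_div_cancel_left c hd
  · intro c hc
    simp only [Finset.mem_Icc, Finset.mem_filter] at hc
    exact Nat.mul_div_cancel' hc.2
  · intro c _; rfl

theorem sum_dvd_range (c d : ℕ) (hd : 0 < d) (g : ℕ → ℝ) :
    ∑ q ∈ Finset.range (d * c + 1), (if d ∣ q then g q else 0) =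
      ∑ q ∈ Finset.range (c + 1), g (d * q) := by
  rw [← Finset.sum_filter]
  symm
  refine Finset.sum_nbij' (fun c => d * c) (fun c => c / d) ?_ ?_ ?_ ?_ ?_
  · intro q hq
    simp only [Finset.mem_range, Finset.mem_filter, Nat.lt_succ_iff] at hq ⊢
    exact ⟨Nat.mul_le_mul_left d hq, dvd_mul_right _ _⟩
  · intro q hq
    simp only [Finset.mem_range, Finset.mem_filter, Nat.lt_succ_iff] at hq ⊢
    exact Nat.div_le_of_le_mul hq.1
  · intro c _
    exact Nat.mul_div_cancel_left c hd
  · intro c hc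
    simp only [Finset.mem_range, Finset.mem_filter] at hc
    exact Nat.mul_div_cancel' hc.2
  · intro c _; rfl

theorem coprime_moebius (X c q : ℕ) (hc : 1 ≤ c) (hcX : c ≤ X) :
    (if q.Coprime c then (1 : ℝ) else 0) =
      ∑ d ∈ Finset.Icc 1 X, if d ∣ c then (if d ∣ q then (ArithmeticFunction.moebius d : ℝ) else 0) else 0 := by
  have h := congrArg (fun f : ArithmeticFunction ℤ => f (q.gcd c)) ArithmeticFunction.moebius_mul_coe_zeta
  simp only [ArithmeticFunction.coe_mul_zeta_apply, ArithmeticFunction.one_apply] at h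
  have h2 : ∑ d ∈ (q.gcd c).divisors, (ArithmeticFunction.moebius d : ℝ) = if q.gcd c = 1 then 1 else 0 := by
    exact_mod_cast h
  have h3 : (if q.Coprime c then (1 : ℝ) else 0) = if q.gcd c = 1 then 1 else 0 := rfl
  rw [h3, ← h2]
  simp_rw [← ite_and]
  rw [← Finset.sum_filter]
  apply Finset.sum_congr _ fun _ _ => rfl
  ext d
  have hg : q.gcd c ≠ 0 := by
    have := Nat.gcd_pos_of_pos_right q hc; omega
  simp only [Nat.mem_divisors, Finset.mem_filter, Finset.mem_Icc, Nat.dvd_gcd_iff]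
  constructor
  · rintro ⟨⟨h1, h2⟩, _⟩
    exact ⟨⟨Nat.pos_of_dvd_of_pos h2 hc, (Nat.le_of_dvd hc h2).trans hcX⟩, h2, h1⟩
  · rintro ⟨_, h1, h2⟩
    exact ⟨⟨h2, h1⟩, hg⟩

theorem moebius_sum (X : ℕ) (F : ℕ → ℕ → ℝ) :
    ∑ c ∈ Finset.Icc 1 X, ∑ q ∈ Finset.range (c + 1), (if q.Coprime c then F c q else 0) =
    ∑ d ∈ Finset.Icc 1 X, (ArithmeticFunction.moebius d : ℝ) *
      ∑ c ∈ Finset.Icc 1 (X / d), ∑ q ∈ Finset.range (c + 1), F (d * c) (d * q) := by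
  have h1 : ∀ c ∈ Finset.Icc 1 X, ∑ q ∈ Finset.range (c + 1), (if q.Coprime c then F c q else 0) =
      ∑ d ∈ Finset.Icc 1 X, if d ∣ c then (ArithmeticFunction.moebius d : ℝ) *
        ∑ q ∈ Finset.range (c + 1), (if d ∣ q then F c q else 0) else 0 := by
    intro c hc
    rw [Finset.mem_Icc] at hc
    have : ∀ q, (if q.Coprime c then F c q else 0) = ∑ d ∈ Finset.Icc 1 X,
        if d ∣ c then (ArithmeticFunction.moebius d : ℝ) * (if d ∣ q then F c q else 0) else 0 := by
      intro q
      have := congrArg (· * F c q) (coprime_moebius X c q hc.1 hc.2)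
      simp only [ite_mul, one_mul, zero_mul, Finset.sum_mul] at this
      rw [this]
      simp only [mul_ite, mul_zero]
    simp_rw [this]
    rw [Finset.sum_comm]
    refine Finset.sum_congr rfl fun d _ => ?_
    split_ifs
    · rw [Finset.mul_sum]
    · simp
  rw [Finset.sum_congr rfl h1, Finset.sum_comm]
  refine Finset.sum_congr rfl fun d hd => ?_
  rw [Finset.mem_Icc] at hd
  rw [sum_dvd_Icc X d hd.1, Finset.mul_sum]
  refine Finset.sum_congr rfl fun c _ => ?_
  rw [sum_dvd_range c d hd.1]

theorem moebius_tail (X : ℕ) :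
    |∑ d ∈ Finset.Icc 1 X, (ArithmeticFunction.moebius d : ℝ) / (d : ℝ) ^ 2 - 6 / Real.pi ^ 2| ≤ 2 / ((X : ℝ) + 1) := by
  have hs : Summable (fun d : ℕ => (ArithmeticFunction.moebius d : ℝ) / (d : ℝ) ^ 2) := by
    refine Summable.of_norm_bounded (g := fun d : ℕ => 1 / (d : ℝ) ^ 2)
      (Real.summable_one_div_nat_pow.2 (by norm_num)) fun d => ?_
    rw [Real.norm_eq_abs, abs_div, abs_of_nonneg (by positivity : (0 : ℝ) ≤ (d : ℝ) ^ 2)]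
    gcongr
    exact_mod_cast ArithmeticFunction.abs_moebius_le_one
  have hsum : ∑' d : ℕ, (ArithmeticFunction.moebius d : ℝ) / (d : ℝ) ^ 2 = 6 / Real.pi ^ 2 := by
    have h := ArithmeticFunction.LSeries_zeta_mul_Lseries_moebius (s := 2) (by norm_num)
    rw [ArithmeticFunction.LSeries_zeta_eq_riemannZeta (by norm_num), riemannZeta_two] at h
    have e : LSeries (fun n => ((ArithmeticFunction.moebius n : ℤ) : ℂ)) 2 =
        ((∑' d : ℕ, (ArithmeticFunction.moebius d : ℝ) / (d : ℝ) ^ 2 : ℝ) : ℂ) := by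
      rw [LSeries, Complex.ofReal_tsum]
      refine tsum_congr fun n => ?_
      rw [LSeries.term_def]
      split_ifs with h0
      · simp [h0]
      · push_cast
        norm_num
    rw [e] at h
    have h3 : (Real.pi : ℝ) ^ 2 / 6 * (∑' d : ℕ, (ArithmeticFunction.moebius d : ℝ) / (d : ℝ) ^ 2) = 1 := by
      exact_mod_cast h
    have : Real.pi ≠ 0 := Real.pi_ne_zero
    field_simp at h3 ⊢
    linarith
  have ht := hs.hasSum.tendsto_sum_nat
  rw [hsum] at ht
  have ht2 := (ht.const_sub (∑ d ∈ Finset.Icc 1 X, (ArithmeticFunction.moebius d : ℝ) / (d : ℝ) ^ 2)).abs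
  refine le_of_tendsto ht2 ?_
  filter_upwards [Filter.eventually_ge_atTop (X + 1)] with n hn
  have e : ∑ i ∈ Finset.range n, (ArithmeticFunction.moebius i : ℝ) / (i : ℝ) ^ 2 =
      ∑ d ∈ Finset.Icc 1 X, (ArithmeticFunction.moebius d : ℝ) / (d : ℝ) ^ 2 +
      ∑ d ∈ Finset.Ioo X n, (ArithmeticFunction.moebius d : ℝ) / (d : ℝ) ^ 2 := by
    rw [← Finset.sum_union]
    · symm
      apply Finset.sum_subset
      · intro x; simp only [Finset.mem_union, Finset.mem_Icc, Finset.mem_Ioo, Finset.mem_range]; omega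
      · intro x; simp only [Finset.mem_union, Finset.mem_Icc, Finset.mem_Ioo, Finset.mem_range]
        intro h1 h2
        have : x = 0 := by omega
        simp [this]
    · rw [Finset.disjoint_left]
      intro x; simp only [Finset.mem_Icc, Finset.mem_Ioo]; omega
  rw [e, sub_add_cancel_left, abs_neg]
  refine (Finset.abs_sum_le_sum_abs _ _).trans (le_trans ?_ (sum_Ioo_inv_sq_le X n))
  refine Finset.sum_le_sum fun d _ => ?_
  rw [abs_div, abs_of_nonneg (by positivity : (0 : ℝ) ≤ (d : ℝ) ^ 2), ← one_div]
  gcongr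
  exact_mod_cast ArithmeticFunction.abs_moebius_le_one

theorem main_sum (α β : ℝ) (hα : 1 ≤ α) (hβ : 1 ≤ β) (hαβ : 1 < α * β) (M : ℕ) (hM1 : 1 ≤ M)
    (hM : 1 ≤ (β - 1 / α) * M) :
    ∃ C > 0, ∀ N : ℕ, 1 ≤ N →
    |∑ c ∈ Finset.Icc 1 (M * N), ∑ q ∈ Finset.range (c + 1), (if q.Coprime c then
        (if α * q ≤ c then max 0 (N + q - β * c) / c else 0) else 0) -
      (N : ℝ) ^ 2 / (2 * (Real.pi ^ 2 / 6)) * Real.log (α * β / (α * β - 1))|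
      ≤ C * (N : ℝ) ^ ((3 : ℝ) / 2) := by
  obtain ⟨C, hC, hT⟩ := T_asymp α β hα hβ hαβ
  set L := Real.log (α * β / (α * β - 1)) with hL
  have hs : Summable (fun n : ℕ => 1 / (n : ℝ) ^ ((3 : ℝ) / 2)) :=
    Real.summable_one_div_nat_rpow.2 (by norm_num)
  set K := ∑' n : ℕ, 1 / (n : ℝ) ^ ((3 : ℝ) / 2) with hKd
  have hK : 0 ≤ K := tsum_nonneg fun n => by positivity
  have hM0 : (1 : ℝ) ≤ M := by exact_mod_cast hM1
  refine ⟨C * (M + 1) * (K + 1) + |L|, by positivity, ?_⟩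
  intro N hN
  have hN0 : (1 : ℝ) ≤ N := by exact_mod_cast hN
  rw [moebius_sum (M * N) (fun c q => if α * q ≤ c then max 0 (N + q - β * c) / c else 0)]
  have hd : ∀ d ∈ Finset.Icc 1 (M * N), 
      |(ArithmeticFunction.moebius d : ℝ) * ∑ c ∈ Finset.Icc 1 (M * N / d), ∑ q ∈ Finset.range (c + 1),
       (if α * (d * q : ℕ) ≤ (d * c : ℕ) then max 0 ((N : ℝ) + (d * q : ℕ) - β * (d * c : ℕ)) / (d * c : ℕ) else 0)
       - (N : ℝ) ^ 2 * L / 2 * ((ArithmeticFunction.moebius d : ℝ) / (d : ℝ) ^ 2)| ≤ 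
       C * (M + 1) * (N : ℝ) ^ ((3 : ℝ) / 2) * (1 / (d : ℝ) ^ ((3 : ℝ) / 2)) := by
    intro d hd
    rw [Finset.mem_Icc] at hd
    have hd0 : (0 : ℝ) < d := by exact_mod_cast hd.1
    have hY : 0 < (N : ℝ) / d := by positivity
    have hZ : (N : ℝ) / d < (β - 1 / α) * ((M * N / d : ℕ) + 1) := by
      have h1 : M * N < (M * N / d + 1) * d := by
        have := Nat.lt_mul_div_succ (M * N) hd.1
        linarith
      have h2 : (M : ℝ) * N < ((M * N / d : ℕ) + 1) * d := by exact_mod_cast h1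
      rw [div_lt_iff₀ hd0]
      have hg : 0 < β - 1 / α := by
        by_contra h
        nlinarith
      nlinarith
    have h := hT (N / d) hY (M * N / d) hZ
    have e : ∑ c ∈ Finset.Icc 1 (M * N / d), ∑ q ∈ Finset.range (c + 1),
       (if α * (d * q : ℕ) ≤ (d * c : ℕ) then max 0 ((N : ℝ) + (d * q : ℕ) - β * (d * c : ℕ)) / (d * c : ℕ) else 0)
       = ∑ c ∈ Finset.Icc 1 (M * N / d), ∑ q ∈ (Finset.range (c + 1)).filter (fun q : ℕ => α * q ≤ c),
        max 0 ((N : ℝ) / d + q - β * c) / c := by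
      refine Finset.sum_congr rfl fun c hc => ?_
      rw [Finset.sum_filter]
      refine Finset.sum_congr rfl fun q hq => ?_
      have hc0 : (0 : ℝ) < c := by rw [Finset.mem_Icc] at hc; exact_mod_cast hc.1
      have i1 : α * ((d * q : ℕ) : ℝ) ≤ ((d * c : ℕ) : ℝ) ↔ α * (q : ℝ) ≤ c := by
        push_cast
        rw [show α * ((d : ℝ) * q) = d * (α * q) by ring]
        exact mul_le_mul_iff_right₀ hd0
      simp only [i1]
      congr 1
      have : (N : ℝ) + (d * q : ℕ) - β * (d * c : ℕ) = d * ((N : ℝ) / d + q - β * c) := by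
        push_cast; field_simp
      rw [this]
      rw [show (0 : ℝ) = d * 0 by simp, ← mul_max_of_nonneg _ _ hd0.le]
      push_cast
      simp only [mul_zero]
      field_simp
    rw [e]
    have e2 : ∀ T : ℝ, (ArithmeticFunction.moebius d : ℝ) * T - (N : ℝ) ^ 2 * L / 2 * ((ArithmeticFunction.moebius d : ℝ) / (d : ℝ) ^ 2)
      = (ArithmeticFunction.moebius d : ℝ) * (T - (N / d : ℝ) ^ 2 * L / 2) := by
      intro T; field_simp
    rw [e2, abs_mul]
    have hmu : |(ArithmeticFunction.moebius d : ℝ)| ≤ 1 := by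
      exact_mod_cast ArithmeticFunction.abs_moebius_le_one
    have hYY : (N : ℝ) / d ≤ M * (N / d : ℝ) ^ ((3 : ℝ) / 2) := by
      have a : (1 : ℝ) / M ≤ N / d := by
        rw [div_le_div_iff₀ (by positivity) hd0]
        have : d ≤ N * M := by linarith [hd.2, mul_comm N M]
        rw [one_mul]; exact_mod_cast this
      have a1 : 1 ≤ (M : ℝ) * (N / d) := by
        rw [div_le_iff₀ (by positivity)] at a; linarith
      have a2 : 1 ≤ ((M : ℝ) * (N / d)) ^ ((1 : ℝ) / 2) := Real.one_le_rpow a1 (by norm_num)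
      rw [Real.mul_rpow (by positivity) hY.le] at a2
      have a3 : (M : ℝ) ^ ((1 : ℝ) / 2) ≤ M := by
        calc (M : ℝ) ^ ((1 : ℝ) / 2) ≤ (M : ℝ) ^ (1 : ℝ) := Real.rpow_le_rpow_of_exponent_le hM0 (by norm_num)
          _ = M := Real.rpow_one _
      rw [show (3 : ℝ) / 2 = 1 + 1 / 2 by norm_num, Real.rpow_add hY, Real.rpow_one]
      have a4 : 0 < (N / d : ℝ) ^ ((1 : ℝ) / 2) := by positivity
      have a5 : 1 ≤ M * (N / d : ℝ) ^ ((1 : ℝ) / 2) := a2.trans (by gcongr)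
      nlinarith
    calc _ ≤ 1 * (C * ((N : ℝ) / d + (N / d : ℝ) ^ ((3 : ℝ) / 2))) := by gcongr
      _ ≤ C * ((M + 1) * (N / d : ℝ) ^ ((3 : ℝ) / 2)) := by rw [one_mul]; gcongr; linarith
      _ = _ := by rw [Real.div_rpow (by positivity) hd0.le]; ring
  have hsum := (Finset.abs_sum_le_sum_abs _ _).trans (Finset.sum_le_sum hd)
  rw [Finset.sum_sub_distrib, ← Finset.mul_sum, ← Finset.mul_sum] at hsum
  have hK2 : ∑ d ∈ Finset.Icc 1 (M * N), 1 / (d : ℝ) ^ ((3 : ℝ) / 2) ≤ K :=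
    hs.sum_le_tsum _ (fun i _ => by positivity)
  have ht := moebius_tail (M * N)
  have hfin : |(N : ℝ) ^ 2 * L / 2 * (∑ d ∈ Finset.Icc 1 (M * N), (ArithmeticFunction.moebius d : ℝ) / (d : ℝ) ^ 2)
     - (N : ℝ) ^ 2 / (2 * (Real.pi ^ 2 / 6)) * L| ≤ |L| * (N : ℝ) ^ ((3 : ℝ) / 2) := by
    have : (N : ℝ) ^ 2 / (2 * (Real.pi ^ 2 / 6)) * L = (N : ℝ) ^ 2 * L / 2 * (6 / Real.pi ^ 2) := by
      have := Real.pi_ne_zero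
      field_simp
      try norm_num
    rw [this, ← mul_sub, abs_mul]
    have b1 : |(N : ℝ) ^ 2 * L / 2| = N ^ 2 * |L| / 2 := by
      rw [abs_div, abs_mul, abs_of_pos (by positivity : (0 : ℝ) < (N : ℝ) ^ 2), abs_of_pos (by norm_num : (0 : ℝ) < 2)]
    rw [b1]
    have b2 : (2 : ℝ) / ((M * N : ℕ) + 1) ≤ 2 / N := by
      apply div_le_div_of_nonneg_left (by norm_num) (by positivity)
      push_cast
      nlinarith
    calc _ ≤ (N : ℝ) ^ 2 * |L| / 2 * (2 / N) := by gcongr; exact ht.trans b2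
      _ = |L| * (N : ℝ) ^ (1 : ℝ) := by rw [Real.rpow_one]; field_simp
      _ ≤ _ := by gcongr; norm_num
  have hN3 : 0 < (N : ℝ) ^ ((3 : ℝ) / 2) := by positivity
  have hsum2 : C * (M + 1) * (N : ℝ) ^ ((3 : ℝ) / 2) * ∑ d ∈ Finset.Icc 1 (M * N), 1 / (d : ℝ) ^ ((3 : ℝ) / 2)
     ≤ C * (M + 1) * (N : ℝ) ^ ((3 : ℝ) / 2) * (K + 1) := by gcongr; linarith
  have := hsum.trans hsum2
  refine (abs_sub_le _ _ _).trans ((add_le_add this hfin).trans (le_of_eq ?_))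
  ring


theorem per_c (α β : ℝ) (hα : 1 ≤ α) (c N : ℕ) (hc : 2 ≤ c) (B : ℝ)
    (hB : ∀ (lo hi : ℕ) (_ : hi ≤ c) (a N : ℤ) (_ : a ≤ N + lo),
      |∑ q ∈ (Finset.Ico lo hi).filter (fun q => q.Coprime c),
      ((((Finset.Ioc a (N + q)).filter (fun x => (c:ℤ) ∣ x * q + 1)).card : ℝ) - ((N:ℝ) + q - a)/c)| ≤ B) :
    |(∑ q ∈ (Finset.range (c + 1)).filter (fun q : ℕ => q.Coprime c ∧ α * q ≤ c),
      (((Finset.Ioc (⌈β * c⌉ - 1) ((N : ℤ) + q)).filter (fun x => (c:ℤ) ∣ x * q + 1)).card : ℝ)) -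
      ∑ q ∈ Finset.range (c + 1), (if q.Coprime c then
        (if α * q ≤ c then max 0 ((N : ℝ) + q - β * c) / c else 0) else 0)| ≤ B + 1 := by
  have hα0 : 0 < α := by linarith
  have hc0 : (0 : ℝ) < c := by have : 0 < c := by omega
                               exact_mod_cast this
  set a : ℤ := ⌈β * c⌉ - 1 with ha
  have ha1 : (a : ℝ) < β * c := by
    rw [ha]; push_cast; linarith [Int.ceil_lt_add_one (β * c)]
  have ha2 : β * c ≤ a + 1 := by
    rw [ha]; push_cast; linarith [Int.le_ceil (β * c)]
  set hi : ℕ := min c (⌊(c : ℝ) / α⌋₊ + 1) with hhi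
  set lo : ℕ := (a - N).toNat with hlo
  have hlo' : a ≤ (N : ℤ) + lo := by omega
  have hQ : (Finset.range (c + 1)).filter (fun q : ℕ => q.Coprime c ∧ α * q ≤ c) =
      (Finset.Ico 0 hi).filter (fun q => q.Coprime c) := by
    ext q
    have hff := congrArg (q ∈ ·) (filter_floor α hα c)
    simp only [Finset.mem_filter, Finset.mem_range, eq_iff_iff] at hff
    simp only [Finset.mem_filter, Finset.mem_range, Finset.mem_Ico, hhi, lt_min_iff]
    constructor
    · rintro ⟨h1, h2, h3⟩
      refine ⟨⟨Nat.zero_le _, ?_, hff.1 ⟨h1, h3⟩⟩, h2⟩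
      rcases Nat.lt_or_ge q c with h | h
      · exact h
      · have : q = c := by omega
        rw [this, Nat.coprime_self] at h2
        omega
    · rintro ⟨⟨_, h1, h2⟩, h3⟩
      exact ⟨by omega, h3, (hff.2 h2).2⟩
  have hm : ∑ q ∈ Finset.range (c + 1), (if q.Coprime c then
        (if α * q ≤ c then max 0 ((N : ℝ) + q - β * c) / c else 0) else 0) =
      ∑ q ∈ (Finset.Ico 0 hi).filter (fun q => q.Coprime c), max 0 ((N : ℝ) + q - β * c) / c := by
    rw [← hQ, Finset.sum_filter]
    refine Finset.sum_congr rfl fun q _ => ?_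
    rw [ite_and]
  rw [hm, hQ]
  have hsub : (Finset.Ico lo hi).filter (fun q => q.Coprime c) ⊆ (Finset.Ico 0 hi).filter (fun q => q.Coprime c) :=
    Finset.filter_subset_filter _ (Finset.Ico_subset_Ico_left (Nat.zero_le _))
  have hless : ∀ q : ℕ, q ∈ (Finset.Ico 0 hi).filter (fun q => q.Coprime c) →
      q ∉ (Finset.Ico lo hi).filter (fun q => q.Coprime c) → (N : ℤ) + q < a := by
    intro q h1 h2
    simp only [Finset.mem_filter, Finset.mem_Ico] at h1 h2
    have : q < lo := by
      by_contra h
      exact h2 ⟨⟨by omega, h1.1.2⟩, h1.2⟩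
    omega
  rw [← Finset.sum_subset hsub, ← Finset.sum_subset hsub]
  · have h1 := hB lo hi (min_le_left _ _) a N hlo'
    have h2 : |∑ q ∈ (Finset.Ico lo hi).filter (fun q => q.Coprime c), (((N : ℤ) : ℝ) + q - a) / c -
        ∑ q ∈ (Finset.Ico lo hi).filter (fun q => q.Coprime c), max 0 ((N : ℝ) + q - β * c) / c| ≤ 1 := by
      rw [← Finset.sum_sub_distrib]
      refine (Finset.abs_sum_le_sum_abs _ _).trans ?_
      have : ∀ q ∈ (Finset.Ico lo hi).filter (fun q => q.Coprime c),
          |(((N : ℤ) : ℝ) + q - a) / c - max 0 ((N : ℝ) + q - β * c) / c| ≤ 1 / c := by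
        intro q hq
        simp only [Finset.mem_filter, Finset.mem_Ico] at hq
        have hq' : a ≤ (N : ℤ) + q := by omega
        have hq2 : (a : ℝ) ≤ (N : ℝ) + q := by exact_mod_cast hq'
        rw [← sub_div, abs_div, abs_of_pos hc0]
        gcongr
        push_cast
        rw [abs_le]
        rcases le_total 0 ((N : ℝ) + q - β * c) with h | h
        · rw [max_eq_right h]; constructor <;> linarith
        · rw [max_eq_left h]; constructor <;> linarith
      refine (Finset.sum_le_sum this).trans ?_
      rw [Finset.sum_const, nsmul_eq_mul]
      have hcard : ((Finset.Ico lo hi).filter (fun q => q.Coprime c)).card ≤ c := by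
        refine (Finset.card_filter_le _ _).trans ?_
        rw [Nat.card_Ico]
        have : hi ≤ c := min_le_left _ _
        omega
      have : (((Finset.Ico lo hi).filter (fun q => q.Coprime c)).card : ℝ) ≤ c := by exact_mod_cast hcard
      rw [mul_one_div, div_le_one hc0]
      exact this
    rw [Finset.sum_sub_distrib] at h1
    exact (abs_sub_le _ _ _).trans (add_le_add h1 h2)
  · intro q hq1 hq2
    have h := hless q hq1 hq2
    have h' : (N : ℝ) + q < a := by exact_mod_cast h
    rw [max_eq_left (by linarith), zero_div]
  · intro q hq1 hq2
    have h := hless q hq1 hq2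
    rw [Finset.Ioc_eq_empty (by omega)]
    simp

/-- The counting finset for `p = c ≥ 2`. -/
noncomputable def Dset (α β : ℝ) (X N : ℕ) : Finset (Σ _ : ℕ, Σ _ : ℕ, ℤ) :=
  (Finset.Icc 2 X).sigma fun c => ((Finset.range (c + 1)).filter
    (fun q : ℕ => q.Coprime c ∧ α * q ≤ c)).sigma fun q =>
      (Finset.Ioc (⌈β * c⌉ - 1) ((N : ℤ) + q)).filter (fun x => (c:ℤ) ∣ x * q + 1)

theorem set_count (α β : ℝ) (hα : 1 ≤ α) (hβ : 1 ≤ β) (M N : ℕ)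
    (hM : 1 ≤ (β - 1 / α) * M) (A : Set (ℤ × ℤ × ℤ × ℤ))
    (hA : A = {m : ℤ × ℤ × ℤ × ℤ | m.2.1 * m.2.2.1 - m.1 * m.2.2.2 = 1 ∧
            α * (m.2.2.2 : ℝ) ≤ (m.2.1 : ℝ) ∧ β * (m.2.1 : ℝ) ≤ (m.1 : ℝ) ∧
            m.2.2.1 < m.1 ∧ m.2.2.2 < m.2.2.1 ∧ 0 ≤ m.2.2.2 ∧
            m.1 - m.2.2.2 ≤ (N : ℤ)}) :
    |(A.ncard : ℝ) - (Dset α β (M * N) N).card| ≤ 2 * (N + 1) := by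
  classical
  have hα0 : 0 < α := by linarith
  -- basic consequences
  have basic : ∀ p' p q' q : ℤ, (p', p, q', q) ∈ A → 1 ≤ p ∧ q ≤ p ∧ p ≤ p' ∧ p ≤ M * N := by
    intro p' p q' q h
    rw [hA] at h
    simp only [Set.mem_setOf_eq] at h
    obtain ⟨h1, h2, h3, h4, h5, h6, h7⟩ := h
    have h6' : (0 : ℝ) ≤ q := by exact_mod_cast h6
    have hqp : (q : ℝ) ≤ p := by nlinarith
    have hqp' : q ≤ p := by exact_mod_cast hqp
    have hp1 : 1 ≤ p := by
      by_contra h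
      have e1 : p = 0 := by omega
      have e2 : q = 0 := by omega
      rw [e1, e2] at h1
      omega
    have hp1' : (1 : ℝ) ≤ p := by exact_mod_cast hp1
    have hpp : (p : ℝ) ≤ p' := by nlinarith
    refine ⟨hp1, hqp', by exact_mod_cast hpp, ?_⟩
    have h7' : (p' : ℝ) - q ≤ N := by exact_mod_cast h7
    have hq : (q : ℝ) ≤ 1 / α * p := by
      rw [one_div, ← div_eq_inv_mul, le_div_iff₀ hα0]; linarith
    have hg : (β - 1 / α) * p ≤ N := by linarith [sub_mul β (1 / α) (p : ℝ)]
    have hM0 : (0 : ℝ) ≤ M := Nat.cast_nonneg M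
    have : (p : ℝ) ≤ M * N := by
      have := mul_le_mul_of_nonneg_left hg hM0
      have := mul_le_mul_of_nonneg_right hM (by linarith : (0 : ℝ) ≤ p)
      nlinarith
    exact_mod_cast this
  set f : (Σ _ : ℕ, Σ _ : ℕ, ℤ) → ℤ × ℤ × ℤ × ℤ :=
    fun t => (t.2.2, (t.1 : ℤ), (t.2.2 * t.2.1 + 1) / t.1, (t.2.1 : ℤ)) with hf
  have hinj : Function.Injective f := by
    rintro ⟨c, q, x⟩ ⟨c', q', x'⟩ h
    simp only [hf, Prod.mk.injEq, Nat.cast_inj] at h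
    obtain ⟨rfl, rfl, _, rfl⟩ := h
    rfl
  have hA2 : A ∩ {m | 2 ≤ m.2.1} = ((Dset α β (M * N) N).image f : Finset _) := by
    ext ⟨p', p, q', q⟩
    simp only [Set.mem_inter_iff, Set.mem_setOf_eq, Finset.coe_image, Set.mem_image, Finset.mem_coe]
    constructor
    · rintro ⟨hm, hp2⟩
      obtain ⟨b1, b2, b3, b4⟩ := basic _ _ _ _ hm
      rw [hA] at hm
      simp only [Set.mem_setOf_eq] at hm
      obtain ⟨h1, h2, h3, h4, h5, h6, h7⟩ := hm
      lift p to ℕ using by omega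
      lift q to ℕ using h6
      have hdvd : (p : ℤ) * q' = p' * q + 1 := by linarith
      refine ⟨⟨p, q, p'⟩, ?_, ?_⟩
      · simp only [Dset, Finset.mem_sigma, Finset.mem_Icc, Finset.mem_filter, Finset.mem_range, Finset.mem_Ioc]
        refine ⟨⟨by exact_mod_cast hp2, by exact_mod_cast b4⟩, ⟨by omega, ?_, by exact_mod_cast h2⟩,
          ⟨?_, by omega⟩, ⟨q', hdvd.symm⟩⟩
        · rw [← Nat.isCoprime_iff_coprime]
          exact ⟨-p', q', by linarith⟩
        · have : ⌈β * (p : ℝ)⌉ ≤ p' := Int.ceil_le.2 (by exact_mod_cast h3)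
          omega
      · simp only [hf, Prod.mk.injEq, true_and, and_true]
        rw [← hdvd]
        exact Int.mul_ediv_cancel_left _ (by omega)
    · rintro ⟨⟨c, q0, x⟩, ht, he⟩
      simp only [hf, Prod.mk.injEq] at he
      obtain ⟨rfl, rfl, rfl, rfl⟩ := he
      simp only [Dset, Finset.mem_sigma, Finset.mem_Icc, Finset.mem_filter, Finset.mem_range, Finset.mem_Ioc] at ht
      obtain ⟨⟨c2, cX⟩, ⟨hq1, hq2, hq3⟩, ⟨hx1, hx2⟩, ⟨k, hk⟩⟩ := ht
      refine ⟨?_, by exact_mod_cast c2⟩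
      rw [hA]
      simp only [Set.mem_setOf_eq]
      have hk' : (x * q0 + 1) / (c : ℤ) = k := by
        rw [hk]; exact Int.mul_ediv_cancel_left _ (by omega)
      rw [hk']
      have hqc : q0 < c := by
        rcases Nat.lt_or_ge q0 c with h | h
        · exact h
        · have : q0 = c := by omega
          rw [this, Nat.coprime_self] at hq2
          omega
      have hxc : β * (c : ℝ) ≤ x := by
        have : ⌈β * (c : ℝ)⌉ ≤ x := by omega
        exact Int.ceil_le.1 this
      have hcx : (c : ℤ) ≤ x := by
        have : (c : ℝ) ≤ x := by nlinarith [Nat.cast_nonneg (α := ℝ) c]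
        exact_mod_cast this
      have c2' : (2 : ℤ) ≤ c := by exact_mod_cast c2
      have hqc' : (q0 : ℤ) + 1 ≤ c := by exact_mod_cast hqc
      have q0' : (0 : ℤ) ≤ q0 := by positivity
      refine ⟨by linarith, by exact_mod_cast hq3, by exact_mod_cast hxc, ?_, ?_, q0', by omega⟩
      · by_contra h
        push Not at h
        nlinarith
      · by_contra h
        push Not at h
        nlinarith
  have hA1 : A ∩ {m | ¬ 2 ≤ m.2.1} ⊆ ((Finset.Icc (1 : ℤ) (N + 1) ×ˢ Finset.Icc (0 : ℤ) 1).image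
      (fun t => (t.1, (1 : ℤ), t.1 * t.2 + 1, t.2)) : Finset (ℤ × ℤ × ℤ × ℤ)) := by
    rintro ⟨p', p, q', q⟩ ⟨hm, hp2⟩
    obtain ⟨b1, b2, b3, b4⟩ := basic _ _ _ _ hm
    rw [hA] at hm
    simp only [Set.mem_setOf_eq] at hm hp2
    obtain ⟨h1, h2, h3, h4, h5, h6, h7⟩ := hm
    have hp : p = 1 := by omega
    subst hp
    simp only [Finset.coe_image, Set.mem_image, Finset.mem_coe, Finset.mem_product, Finset.mem_Icc, Prod.exists, Prod.mk.injEq]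
    refine ⟨p', q, ⟨⟨by omega, by omega⟩, h6, by omega⟩, rfl, trivial, by linarith, rfl⟩
  have hsplit : A = (A ∩ {m | 2 ≤ m.2.1}) ∪ (A ∩ {m | ¬ 2 ≤ m.2.1}) := by
    rw [← Set.inter_union_distrib_left]
    ext m
    simp only [Set.mem_inter_iff, Set.mem_union, Set.mem_setOf_eq]
    tauto
  have hn1 : (A ∩ {m | ¬ 2 ≤ m.2.1}).ncard ≤ 2 * (N + 1) := by
    refine (Set.ncard_le_ncard hA1 (Finset.finite_toSet _)).trans ?_
    rw [Set.ncard_coe_finset]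
    refine Finset.card_image_le.trans ?_
    rw [Finset.card_product, Int.card_Icc, Int.card_Icc]
    have : ((N : ℤ) + 1 + 1 - 1).toNat = N + 1 := by omega
    rw [this, show ((1 : ℤ) + 1 - 0).toNat = 2 from rfl]
    omega
  have hn2 : (A ∩ {m | 2 ≤ m.2.1}).ncard = (Dset α β (M * N) N).card := by
    rw [hA2, Set.ncard_coe_finset, Finset.card_image_of_injective _ hinj]
  have hfin : A.Finite := by
    rw [hsplit]
    apply Set.Finite.union
    · rw [hA2]; exact Finset.finite_toSet _
    · exact (Finset.finite_toSet _).subset hA1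
  have hle : A.ncard ≤ (Dset α β (M * N) N).card + 2 * (N + 1) := by
    conv_lhs => rw [hsplit]
    refine (Set.ncard_union_le _ _).trans ?_
    omega
  have hge : (Dset α β (M * N) N).card ≤ A.ncard := by
    rw [← hn2]
    exact Set.ncard_le_ncard Set.inter_subset_left hfin
  have hle' : (A.ncard : ℝ) ≤ (Dset α β (M * N) N).card + 2 * (N + 1) := by exact_mod_cast hle
  have hge' : ((Dset α β (M * N) N).card : ℝ) ≤ A.ncard := by exact_mod_cast hge
  rw [abs_le]
  constructor <;> linarith

theorem D_sum (α β : ℝ) (hα : 1 ≤ α) (hβ : 1 ≤ β) (ε : ℝ) (hε : 0 < ε) : ∃ C > 0, ∀ X N : ℕ, 1 ≤ X → 1 ≤ N →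
    |((Dset α β X N).card : ℝ) - ∑ c ∈ Finset.Icc 1 X, ∑ q ∈ Finset.range (c + 1), (if q.Coprime c then
        (if α * q ≤ c then max 0 ((N : ℝ) + q - β * c) / c else 0) else 0)| ≤
      C * (X : ℝ) ^ ((3 : ℝ) / 2 + ε) + X + 4 * N := by
  obtain ⟨C, hC, hE⟩ := err_sum ε hε
  have hST : ∀ c : ℕ, ∃ s t : ℕ, 1 ≤ c → 0 < s ∧ 0 < t ∧ s^2*t^3 ∣ c ∧ ∀ (lo hi : ℕ) (_ : hi ≤ c) (a N : ℤ) (_ : a ≤ N + lo), |∑ q ∈ (Finset.Ico lo hi).filter (fun q => q.Coprime c), ((((Finset.Ioc a (N + q)).filter (fun x => (c:ℤ) ∣ x * q + 1)).card : ℝ) - ((N:ℝ) + q - a)/c)| ≤ 2*(2+Real.log c)*((1+Real.log c)*(c.divisors.card:ℝ)^2*Real.sqrt c*Real.sqrt (s^2*t^3)) := by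
    intro c
    by_cases hc : 1 ≤ c
    · obtain ⟨s, t, h⟩ := count_c c hc
      exact ⟨s, t, fun _ => h⟩
    · exact ⟨0, 0, fun h => absurd h hc⟩
  choose S T hST using hST
  refine ⟨C, hC, ?_⟩
  intro X N hX hN
  have hN0 : (1 : ℝ) ≤ N := by exact_mod_cast hN
  have hsum := hE X hX S T (fun c hc => ⟨(hST c hc).1, (hST c hc).2.1, (hST c hc).2.2.1⟩)
  have hIcc : Finset.Icc 1 X = insert 1 (Finset.Icc 2 X) := by
    ext x; simp only [Finset.mem_Icc, Finset.mem_insert]; omega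
  have hnot : 1 ∉ Finset.Icc 2 X := by simp
  rw [hIcc, Finset.sum_insert hnot] at hsum
  rw [hIcc, Finset.sum_insert hnot]
  have hD : ((Dset α β X N).card : ℝ) = ∑ c ∈ Finset.Icc 2 X,
      ∑ q ∈ (Finset.range (c + 1)).filter (fun q : ℕ => q.Coprime c ∧ α * q ≤ c),
      (((Finset.Ioc (⌈β * c⌉ - 1) ((N : ℤ) + q)).filter (fun x => (c:ℤ) ∣ x * q + 1)).card : ℝ) := by
    rw [Dset, Finset.card_sigma]
    push_cast
    refine Finset.sum_congr rfl fun c _ => ?_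
    rw [Finset.card_sigma]
    push_cast
    refine Finset.sum_congr (by congr) fun q _ => ?_
    congr
  have h2 : ∀ c ∈ Finset.Icc 2 X, _ := fun c hc =>
    per_c α β hα c N (Finset.mem_Icc.1 hc).1 _ (hST c (by have := (Finset.mem_Icc.1 hc).1; omega)).2.2.2
  have h3 := (Finset.abs_sum_le_sum_abs _ _).trans (Finset.sum_le_sum h2)
  rw [Finset.sum_sub_distrib, ← hD, Finset.sum_add_distrib, Finset.sum_const, nsmul_eq_mul, mul_one, Nat.card_Icc] at h3
  have h4 : (((X + 1 - 2 : ℕ)) : ℝ) ≤ X := by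
    have : X + 1 - 2 ≤ X := by omega
    exact_mod_cast this
  have h5 : |∑ q ∈ Finset.range (1 + 1), (if q.Coprime 1 then
        (if α * q ≤ (1 : ℕ) then max 0 ((N : ℝ) + q - β * (1 : ℕ)) / (1 : ℕ) else 0) else 0)| ≤ 4 * N := by
    refine (Finset.abs_sum_le_sum_abs _ _).trans ?_
    have : ∀ q ∈ Finset.range (1 + 1), |(if q.Coprime 1 then
        (if α * q ≤ (1 : ℕ) then max 0 ((N : ℝ) + q - β * (1 : ℕ)) / (1 : ℕ) else 0) else 0)| ≤ 2 * (N : ℝ) := by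
      intro q hq
      rw [Finset.mem_range] at hq
      have hq1 : (q : ℝ) ≤ 1 := by
        have : q ≤ 1 := by omega
        exact_mod_cast this
      split_ifs
      · rw [Nat.cast_one, div_one, mul_one, abs_of_nonneg (le_max_left _ _)]
        apply max_le <;> linarith
      · simp
      · simp
    refine (Finset.sum_le_sum this).trans ?_
    simp only [Finset.sum_const, Finset.card_range]
    rw [nsmul_eq_mul]
    push_cast
    linarith
  have h6 : 0 ≤ 2*(2+Real.log (1 : ℕ))*((1+Real.log (1 : ℕ))*((1 : ℕ).divisors.card:ℝ)^2*Real.sqrt (1 : ℕ)*Real.sqrt ((S 1 : ℝ)^2*(T 1 : ℝ)^3)) := by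
    rw [Nat.cast_one, Real.log_one]; positivity
  have e : ∀ a b d : ℝ, a - (b + d) = (a - d) + (- b) := by intros; ring
  rw [e]
  refine (abs_add_le _ _).trans ?_
  rw [abs_neg]
  have h7 := (le_add_of_nonneg_left h6).trans hsum
  exact add_le_add (h3.trans (add_le_add h7 h4)) h5

theorem stmt19_aux (α β : ℝ) (hα : 1 ≤ α) (hβ : 1 ≤ β) (hαβ : 1 < α * β) :
    ∀ ε > (0 : ℝ), ∃ C > (0 : ℝ), ∀ N : ℕ, 1 ≤ N →
      |({m : ℤ × ℤ × ℤ × ℤ |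
            m.2.1 * m.2.2.1 - m.1 * m.2.2.2 = 1 ∧
            α * (m.2.2.2 : ℝ) ≤ (m.2.1 : ℝ) ∧ β * (m.2.1 : ℝ) ≤ (m.1 : ℝ) ∧
            m.2.2.1 < m.1 ∧ m.2.2.2 < m.2.2.1 ∧ 0 ≤ m.2.2.2 ∧
            m.1 - m.2.2.2 ≤ (N : ℤ)}.ncard : ℝ) -
          (N : ℝ) ^ 2 / (2 * (Real.pi ^ 2 / 6)) * Real.log (α * β / (α * β - 1))|
        ≤ C * (N : ℝ) ^ ((3 : ℝ) / 2 + ε) := by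
  intro ε hε
  have hα0 : 0 < α := by linarith
  have hγ : 0 < β - 1 / α := by
    have : 1 / α < β := by rw [div_lt_iff₀ hα0]; linarith
    linarith
  obtain ⟨M, hM⟩ := exists_nat_ge (1 / (β - 1 / α))
  have hM' : 1 ≤ (β - 1 / α) * M := by
    rw [div_le_iff₀ hγ] at hM; linarith
  have hM1 : 1 ≤ M := by
    rcases Nat.eq_zero_or_pos M with h | h
    · rw [h] at hM'; norm_num at hM'
    · exact h
  obtain ⟨C1, hC1, h1⟩ := D_sum α β hα hβ ε hε
  obtain ⟨C2, hC2, h2⟩ := main_sum α β hα hβ hαβ M hM1 hM'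
  refine ⟨C1 * (M : ℝ) ^ ((3 : ℝ) / 2 + ε) + C2 + M + 8, by positivity, ?_⟩
  intro N hN
  have hN0 : (1 : ℝ) ≤ N := by exact_mod_cast hN
  have a1 := h1 (M * N) N (Nat.mul_pos hM1 hN) hN
  have a2 := h2 N hN
  have a3 := set_count α β hα hβ M N hM' _ rfl
  push_cast at a1
  rw [Real.mul_rpow (by positivity) (by positivity)] at a1
  have b1 : (N : ℝ) ≤ (N : ℝ) ^ ((3 : ℝ) / 2 + ε) := by
    calc (N : ℝ) = (N : ℝ) ^ (1 : ℝ) := (Real.rpow_one _).symm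
      _ ≤ _ := Real.rpow_le_rpow_of_exponent_le hN0 (by linarith)
  have b2 : (N : ℝ) ^ ((3 : ℝ) / 2) ≤ (N : ℝ) ^ ((3 : ℝ) / 2 + ε) :=
    Real.rpow_le_rpow_of_exponent_le hN0 (by linarith)
  have b3 := mul_le_mul_of_nonneg_left b2 hC2.le
  have b4 := mul_le_mul_of_nonneg_left b1 (Nat.cast_nonneg (α := ℝ) M)
  refine (abs_sub_le _ _ _).trans ((add_le_add a3 ((abs_sub_le _ _ _).trans (add_le_add a1 a2))).trans ?_)
  have : ∀ R : ℝ, (C1 * (M : ℝ) ^ ((3 : ℝ) / 2 + ε) + C2 + M + 8) * R =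
    C1 * ((M : ℝ) ^ ((3 : ℝ) / 2 + ε) * R) + C2 * R + M * R + 8 * R := by intro R; ring
  rw [this]
  linarith

theorem stmt19 (α β : ℝ) (hα : 1 ≤ α) (hβ : 1 ≤ β) (hαβ : 1 < α * β) :
    ∀ ε > (0 : ℝ), ∃ C > (0 : ℝ), ∀ N : ℕ, 1 ≤ N →
      |({m : ℤ × ℤ × ℤ × ℤ |
            -- (p', p, q', q) = (m.1, m.2.1, m.2.2.1, m.2.2.2), det (p',-p;q',-q) = 1
            m.2.1 * m.2.2.1 - m.1 * m.2.2.2 = 1 ∧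
            α * (m.2.2.2 : ℝ) ≤ (m.2.1 : ℝ) ∧ β * (m.2.1 : ℝ) ≤ (m.1 : ℝ) ∧
            m.2.2.1 < m.1 ∧ m.2.2.2 < m.2.2.1 ∧ 0 ≤ m.2.2.2 ∧
            m.1 - m.2.2.2 ≤ (N : ℤ)}.ncard : ℝ) -
          (N : ℝ) ^ 2 / (2 * (Real.pi ^ 2 / 6)) * Real.log (α * β / (α * β - 1))|
        ≤ C * (N : ℝ) ^ ((3 : ℝ) / 2 + ε) := by
  exact stmt19_aux α β hα hβ hαβ
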